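/- arXiv:1602.00347 — 4 statements merged into one kernel-verified Lean document; each statement's English description precedes it below -/
import Mathlib

section
/- Let (L,H) be a cover of a finite simple graph G, let p̂ > 0, and let p: V(H) → [0,p̂]. If the tuple (G,L,H,p) is nice, then G admits a p-moderate (L,H)-coloring. -/
open Classical Finset Real

/-- A cover `(L, H)` of a graph `G`. Colors form a type `W`; `toFun` sends each color to the
vertex it belongs to, so that the list of `v` is `L v = toFun ⁻¹' {v}` (the lists are then
automatically pairwise disjoint). `graph` is the cover graph `H`. -/
structure Cover {V : Type*} (G : SimpleGraph V) (W : Type*) where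
  toFun : W → V
  graph : SimpleGraph W
  adj_map : ∀ ⦃x y : W⦄, graph.Adj x y → G.Adj (toFun x) (toFun y)
  matching : ∀ ⦃x y y' : W⦄, graph.Adj x y → graph.Adj x y' → toFun y = toFun y' → y = y'

namespace Cover

variable {V W : Type*} {G : SimpleGraph V}

/-- `I` is an `(L,H)`-coloring of `G`: an independent set of `H` meeting every list. -/
def IsColoring (C : Cover G W) (I : Set W) : Prop :=
  (∀ ⦃x⦄, x ∈ I → ∀ ⦃y⦄, y ∈ I → ¬ C.graph.Adj x y) ∧ ∀ v : V, ∃ x ∈ I, C.toFun x = v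

/-- `G` is `(L,H)`-colorable. -/
def Colorable (C : Cover G W) : Prop := ∃ I : Set W, C.IsColoring I

end Cover

/-- `G` is `k`-correspondence-colorable. -/
def CorrColorable {V : Type} [Fintype V] (G : SimpleGraph V) (k : ℕ) : Prop :=
  ∀ (W : Type) [Fintype W] (C : Cover G W),
    (∀ v : V, k ≤ Fintype.card {x : W // C.toFun x = v}) → C.Colorable

/-- The correspondence chromatic number `χ_c(G)`. -/
noncomputable def corrChromaticNumber {V : Type} [Fintype V] (G : SimpleGraph V) : ℕ :=
  sInf {k : ℕ | CorrColorable G k}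

namespace Cover

variable {V W : Type} {G : SimpleGraph V}

/-- A color `x` is `p`-moderate (relative to the threshold `p̂`) if `0 < p(x) < p̂`. -/
def ModerateColor (p : W → ℝ) (phat : ℝ) (x : W) : Prop := 0 < p x ∧ p x < phat

open Classical in
/-- `p_m(v) = Σ_{x ∈ L(v) ∩ M} p(x)`, where `M` is the set of `p`-moderate colors. -/
noncomputable def moderateVertexWeight [Fintype W] (C : Cover G W) (p : W → ℝ) (phat : ℝ)
    (v : V) : ℝ :=
  ∑ x : W, if C.toFun x = v ∧ ModerateColor p phat x then p x else 0

open Classical in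
/-- `p_m(uv) = Σ p(x)p(y)`, the sum over edges `xy` of `H` with `x ∈ L(u) ∩ M`,
`y ∈ L(v) ∩ M`. -/
noncomputable def moderateEdgeWeight [Fintype W] (C : Cover G W) (p : W → ℝ) (phat : ℝ)
    (u v : V) : ℝ :=
  ∑ x : W, ∑ y : W,
    if C.toFun x = u ∧ C.toFun y = v ∧ C.graph.Adj x y ∧
        ModerateColor p phat x ∧ ModerateColor p phat y then p x * p y else 0

open Classical in
/-- The tuple `(G, L, H, p)` is *nice*. -/
def Nice [Fintype V] [Fintype W] (C : Cover G W) [DecidableRel G.Adj] (p : W → ℝ) (phat : ℝ) : Prop :=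
  ∃ δ : ℝ, 0 < δ ∧
    (∀ v : V, δ ≤ C.moderateVertexWeight p phat v) ∧
    (∀ x : W, ModerateColor p phat x → p x ≤ δ / 2) ∧
    (∀ v : V, ∑ u ∈ G.neighborFinset v, C.moderateEdgeWeight p phat u v ≤ δ ^ 2 / 4)

end Cover

section ProductExpectation

variable {V W : Type*}

/-- `f` is a proper partial coloring on `S`: no two vertices of `S` get adjacent colors. -/
def ProperOn (H : SimpleGraph W) (S : Finset V) (f : V → W) : Prop :=
  ∀ u ∈ S, ∀ v ∈ S, ¬ H.Adj (f u) (f v)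

/-- The indicator function of `ProperOn H S`. -/
noncomputable def properIndicator (H : SimpleGraph W) (S : Finset V) (f : V → W) : ℝ :=
  if ProperOn H S f then 1 else 0

theorem properIndicator_nonneg (H : SimpleGraph W) (S : Finset V) (f : V → W) :
    0 ≤ properIndicator H S f := by
  unfold properIndicator
  split_ifs <;> norm_num

theorem properIndicator_update (H : SimpleGraph W) {S : Finset V} {v : V} (hv : v ∉ S)
    (f : V → W) (x : W) :
    properIndicator H S (Function.update f v x) = properIndicator H S f := by
  have h : ∀ u ∈ S, Function.update f v x u = f u := fun u hu =>
    Function.update_of_ne (ne_of_mem_of_not_mem hu hv) _ _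
  have : ProperOn H S (Function.update f v x) ↔ ProperOn H S f :=
    forall₂_congr fun u hu => forall₂_congr fun w hw => by rw [h u hu, h w hw]
  simp only [properIndicator, this]

theorem le_properIndicator_insert (H : SimpleGraph W) (S : Finset V) (v : V) (f : V → W) :
    properIndicator H S f - ∑ u ∈ S, properIndicator H (S.erase u) f *
      (if H.Adj (f u) (f v) then 1 else 0) ≤ properIndicator H (insert v S) f := by
  have hterm : ∀ u ∈ S, 0 ≤ properIndicator H (S.erase u) f *
      (if H.Adj (f u) (f v) then (1 : ℝ) else 0) := fun u _ =>
    mul_nonneg (properIndicator_nonneg H _ f) (by split_ifs <;> norm_num)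
  by_cases hS : ProperOn H S f
  · by_cases hconf : ∃ u ∈ S, H.Adj (f u) (f v)
    · obtain ⟨u, hu, huv⟩ := hconf
      have herase : ProperOn H (S.erase u) f := fun a ha b hb =>
        hS a (Finset.mem_of_mem_erase ha) b (Finset.mem_of_mem_erase hb)
      have hle := Finset.single_le_sum hterm hu
      have h1 : properIndicator H S f = 1 := if_pos hS
      have h2 : properIndicator H (S.erase u) f = 1 := if_pos herase
      rw [h2, if_pos huv] at hle
      linarith [properIndicator_nonneg H (insert v S) f]
    · push Not at hconf
      have hins : ProperOn H (insert v S) f := by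
        intro a ha b hb
        rw [Finset.mem_insert] at ha hb
        rcases ha with rfl | ha <;> rcases hb with rfl | hb
        · exact H.loopless.irrefl _
        · exact fun h => hconf b hb h.symm
        · exact hconf a ha
        · exact hS a ha b hb
      rw [properIndicator, properIndicator, if_pos hS, if_pos hins]
      linarith [Finset.sum_nonneg hterm]
  · have h0 : properIndicator H S f = 0 := if_neg hS
    linarith [Finset.sum_nonneg hterm, properIndicator_nonneg H (insert v S) f]

theorem prod_update_mul [Fintype V] (q : V → W → ℝ) (f : V → W) (v : V) (x : W) :
    (∏ i, q i (Function.update f v x i)) * q v (f v) = (∏ i, q i (f i)) * q v x := by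
  rw [← Finset.mul_prod_erase univ _ (mem_univ v),
    ← Finset.mul_prod_erase univ (fun i => q i (f i)) (mem_univ v)]
  have h : ∏ i ∈ univ.erase v, q i (Function.update f v x i) = ∏ i ∈ univ.erase v, q i (f i) :=
    Finset.prod_congr rfl fun i hi => by
      rw [Function.update_of_ne (Finset.ne_of_mem_erase hi)]
  rw [h, Function.update_self]
  ring

variable [Fintype V] [Fintype W]

/-- The expectation of `F f` when the values `f v` are chosen independently, `f v` having the
distribution `q v`. -/
noncomputable def productExpectation (q : V → W → ℝ) (F : (V → W) → ℝ) : ℝ :=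
  ∑ f : V → W, (∏ v, q v (f v)) * F f

/-- Resampling one coordinate does not change the expectation. -/
theorem productExpectation_resample {q : V → W → ℝ} (hq : ∀ v, ∑ x, q v x = 1)
    (v : V) (F : (V → W) → ℝ) :
    productExpectation q (fun f => ∑ x, q v x * F (Function.update f v x)) =
      productExpectation q F := by
  have swap : ∑ a : (V → W) × W, (∏ i, q i (a.1 i)) * (q v a.2 * F (Function.update a.1 v a.2)) =
      ∑ a : (V → W) × W, (∏ i, q i (a.1 i)) * (q v a.2 * F a.1) := by
    refine Finset.sum_nbij' (fun a => (Function.update a.1 v a.2, a.1 v))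
      (fun a => (Function.update a.1 v a.2, a.1 v)) (by simp) (by simp) (by simp) (by simp) ?_
    rintro ⟨f, x⟩ -
    simp only [← mul_assoc, prod_update_mul]
  simp only [Fintype.sum_prod_type] at swap
  simp only [productExpectation, Finset.mul_sum, swap]
  refine Finset.sum_congr rfl fun f _ => ?_
  rw [← Finset.mul_sum, ← Finset.sum_mul, hq, one_mul]

theorem productExpectation_mono {q : V → W → ℝ} (hq : ∀ v x, 0 ≤ q v x)
    {F F' : (V → W) → ℝ} (h : ∀ f, F f ≤ F' f) :
    productExpectation q F ≤ productExpectation q F' :=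
  Finset.sum_le_sum fun f _ =>
    mul_le_mul_of_nonneg_left (h f) (Finset.prod_nonneg fun v _ => hq v (f v))

theorem productExpectation_sub_sum (q : V → W → ℝ) (F : (V → W) → ℝ) (S : Finset V)
    (F' : V → (V → W) → ℝ) :
    productExpectation q (fun f => F f - ∑ u ∈ S, F' u f) =
      productExpectation q F - ∑ u ∈ S, productExpectation q (F' u) := by
  simp only [productExpectation, mul_sub, Finset.sum_sub_distrib, Finset.mul_sum]
  rw [Finset.sum_comm]

/-- A function of the coordinates `u` and `v` is independent of one that ignores them. -/
theorem productExpectation_mul_pair {q : V → W → ℝ} (hq : ∀ v, ∑ x, q v x = 1) {u v : V}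
    (huv : u ≠ v) (A : (V → W) → ℝ) (hu : ∀ f x, A (Function.update f u x) = A f)
    (hv : ∀ f x, A (Function.update f v x) = A f) (B : W → W → ℝ) :
    productExpectation q (fun f => A f * B (f u) (f v)) =
      productExpectation q A * ∑ x, ∑ y, q u x * q v y * B x y := by
  rw [← productExpectation_resample hq v, ← productExpectation_resample hq u]
  simp only [hu, hv, Function.update_self, Function.update_of_ne huv]
  rw [productExpectation, productExpectation, Finset.sum_mul]
  refine Finset.sum_congr rfl fun f _ => ?_
  rw [mul_assoc]
  congr 1
  simp only [Finset.mul_sum]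
  exact Finset.sum_congr rfl fun x _ => Finset.sum_congr rfl fun y _ => by ring

/-- If the expected number of conflicts at each vertex is at most `1/4`, then making one more
vertex properly colored costs at most a factor of `2` in probability. -/
theorem half_productExpectation_le_insert {q : V → W → ℝ} (hq0 : ∀ v x, 0 ≤ q v x)
    (hq : ∀ v, ∑ x, q v x = 1) (H : SimpleGraph W)
    (hconf : ∀ v, ∑ u, ∑ x, ∑ y, q u x * q v y * (if H.Adj x y then 1 else 0) ≤ 1 / 4)
    (S : Finset V) (v : V) :
    productExpectation q (properIndicator H S) / 2 ≤
      productExpectation q (properIndicator H (insert v S)) := by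
  have hnonneg : ∀ T : Finset V, 0 ≤ productExpectation q (properIndicator H T) := fun T =>
    Finset.sum_nonneg fun f _ =>
      mul_nonneg (Finset.prod_nonneg fun v _ => hq0 v (f v)) (properIndicator_nonneg H T f)
  induction S using Finset.strongInduction generalizing v with
  | H S ih =>
    by_cases hv : v ∈ S
    · rw [Finset.insert_eq_of_mem hv]
      linarith [hnonneg S]
    have hpair : ∀ u, 0 ≤ ∑ x, ∑ y, q u x * q v y * (if H.Adj x y then (1 : ℝ) else 0) :=
      fun u => Finset.sum_nonneg fun x _ => Finset.sum_nonneg fun y _ =>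
        mul_nonneg (mul_nonneg (hq0 u x) (hq0 v y)) (by split_ifs <;> norm_num)
    have hmono := productExpectation_mono hq0 (le_properIndicator_insert H S v)
    rw [productExpectation_sub_sum q (properIndicator H S) S fun u f =>
      properIndicator H (S.erase u) f * (if H.Adj (f u) (f v) then 1 else 0)] at hmono
    have hterm : ∀ u ∈ S, productExpectation q (fun f => properIndicator H (S.erase u) f *
        (if H.Adj (f u) (f v) then 1 else 0)) ≤
        2 * productExpectation q (properIndicator H S) *
          ∑ x, ∑ y, q u x * q v y * (if H.Adj x y then 1 else 0) := by
      intro u hu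
      rw [productExpectation_mul_pair hq (ne_of_mem_of_not_mem hu hv)
        (properIndicator H (S.erase u))
        (properIndicator_update H (Finset.notMem_erase u S))
        (properIndicator_update H fun h => hv (Finset.mem_of_mem_erase h))
        fun x y => if H.Adj x y then 1 else 0]
      have := ih (S.erase u) (Finset.erase_ssubset hu) u
      rw [Finset.insert_erase hu] at this
      exact mul_le_mul_of_nonneg_right (by linarith) (hpair u)
    have hsum := Finset.sum_le_sum hterm
    rw [← Finset.mul_sum] at hsum
    have hquarter := (Finset.sum_le_sum_of_subset_of_nonneg (Finset.subset_univ S)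
      fun u _ _ => hpair u).trans (hconf v)
    have := mul_le_mul_of_nonneg_left hquarter
      (mul_nonneg zero_le_two (hnonneg S))
    linarith

theorem exists_independent_choice {q : V → W → ℝ} (hq0 : ∀ v x, 0 ≤ q v x)
    (hq : ∀ v, ∑ x, q v x = 1) (H : SimpleGraph W)
    (hconf : ∀ v, ∑ u, ∑ x, ∑ y, q u x * q v y * (if H.Adj x y then 1 else 0) ≤ 1 / 4) :
    ∃ f : V → W, (∀ v, q v (f v) ≠ 0) ∧ ∀ u v, ¬ H.Adj (f u) (f v) := by
  have hpos : ∀ S : Finset V, 0 < productExpectation q (properIndicator H S) := by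
    intro S
    induction S using Finset.induction_on with
    | empty =>
      have : productExpectation q (properIndicator H ∅) = ∏ v, ∑ x, q v x := by
        simp [productExpectation, properIndicator, ProperOn, Fintype.prod_sum]
      simp [this, hq]
    | insert v S _ ih =>
      linarith [half_productExpectation_le_insert hq0 hq H hconf S v]
  obtain ⟨f, -, hf⟩ := Finset.exists_ne_zero_of_sum_ne_zero (hpos univ).ne'
  refine ⟨f, fun v => Finset.prod_ne_zero_iff.1 (left_ne_zero_of_mul hf) v (mem_univ v), ?_⟩
  by_contra hcon
  refine right_ne_zero_of_mul hf (if_neg fun hproper => hcon fun u v => ?_)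
  exact hproper u (mem_univ u) v (mem_univ v)

end ProductExpectation

/-- If the tuple `(G, L, H, p)` is nice, then `G` admits a `p`-moderate
`(L,H)`-coloring. -/
theorem exists_moderate_coloring_of_nice
    {V W : Type} [Fintype V] [Fintype W] {G : SimpleGraph V} [DecidableRel G.Adj]
    (C : Cover G W) (phat : ℝ) (hphat : 0 < phat)
    (p : W → ℝ) (hp : ∀ x, 0 ≤ p x ∧ p x ≤ phat)
    (hnice : C.Nice p phat) :
    ∃ I : Set W, C.IsColoring I ∧ ∀ x ∈ I, Cover.ModerateColor p phat x := by
  obtain ⟨δ, hδ, hvertex, -, hedge⟩ := hnice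
  set m := C.moderateVertexWeight p phat with hm
  have hmpos : ∀ v, 0 < m v := fun v => hδ.trans_le (hvertex v)
  let w : V → W → ℝ := fun v x =>
    if C.toFun x = v ∧ Cover.ModerateColor p phat x then p x else 0
  have hw0 : ∀ v x, 0 ≤ w v x := fun v x => by
    dsimp only [w]
    split_ifs
    exacts [(hp x).1, le_rfl]
  have hweight : ∀ u v, ∑ x, ∑ y, w u x * w v y * (if C.graph.Adj x y then 1 else 0) =
      C.moderateEdgeWeight p phat u v := fun u v => by
    unfold Cover.moderateEdgeWeight
    refine Finset.sum_congr rfl fun x _ => Finset.sum_congr rfl fun y _ => ?_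
    simp only [w, ite_mul, mul_ite, mul_one, mul_zero, zero_mul, ← ite_and]
    exact if_congr (by tauto) rfl rfl
  have hnonadj : ∀ u v, ¬ G.Adj v u → C.moderateEdgeWeight p phat u v = 0 := fun u v huv =>
    Finset.sum_eq_zero fun x _ => Finset.sum_eq_zero fun y _ => if_neg <| by
      rintro ⟨rfl, rfl, hadj, -⟩
      exact huv (C.adj_map hadj).symm
  have hedge_nonneg : ∀ u v, 0 ≤ C.moderateEdgeWeight p phat u v := fun u v => by
    rw [← hweight]
    exact Finset.sum_nonneg fun x _ => Finset.sum_nonneg fun y _ =>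
      mul_nonneg (mul_nonneg (hw0 u x) (hw0 v y)) (by split_ifs <;> norm_num)
  have hconf : ∀ v, ∑ u, ∑ x, ∑ y, w u x / m u * (w v y / m v) *
      (if C.graph.Adj x y then 1 else 0) ≤ 1 / 4 := by
    intro v
    calc ∑ u, ∑ x, ∑ y, w u x / m u * (w v y / m v) * (if C.graph.Adj x y then 1 else 0)
        = ∑ u, C.moderateEdgeWeight p phat u v / (m u * m v) := by
          refine Finset.sum_congr rfl fun u _ => ?_
          rw [← hweight, Finset.sum_div]
          refine Finset.sum_congr rfl fun x _ => ?_
          rw [Finset.sum_div]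
          refine Finset.sum_congr rfl fun y _ => ?_
          rw [div_mul_div_comm, div_mul_eq_mul_div]
      _ ≤ ∑ u, C.moderateEdgeWeight p phat u v / δ ^ 2 := by
          refine Finset.sum_le_sum fun u _ => ?_
          refine div_le_div_of_nonneg_left (hedge_nonneg u v) (by positivity) ?_
          rw [sq]
          exact mul_le_mul (hvertex u) (hvertex v) hδ.le (hmpos u).le
      _ = (∑ u ∈ G.neighborFinset v, C.moderateEdgeWeight p phat u v) / δ ^ 2 := by
          rw [← Finset.sum_div]
          congr 1
          refine (Finset.sum_subset (Finset.subset_univ _) fun u _ hu => hnonadj u v ?_).symm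
          simpa using hu
      _ ≤ 1 / 4 := by
          rw [div_le_iff₀ (by positivity)]
          linarith [hedge v]
  obtain ⟨f, hf, hindep⟩ := exists_independent_choice (q := fun v x => w v x / m v)
    (fun v x => div_nonneg (hw0 v x) (hmpos v).le)
    (fun v => by rw [← Finset.sum_div]; exact div_self (hmpos v).ne') C.graph hconf
  have hmod : ∀ v, C.toFun (f v) = v ∧ Cover.ModerateColor p phat (f v) := fun v => by
    by_contra h
    exact hf v (by simp only [w, if_neg h, zero_div])
  refine ⟨Set.range f, ⟨?_, fun v => ⟨f v, ⟨v, rfl⟩, (hmod v).1⟩⟩, ?_⟩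
  · rintro _ ⟨u, rfl⟩ _ ⟨v, rfl⟩
    exact hindep u v
  · rintro _ ⟨v, rfl⟩
    exact (hmod v).2
end

section
/- For every ε > 0 there exists Δ₀ such that the following holds for all Δ ≥ Δ₀. Let G be a finite simple triangle-free graph with maximum degree at most Δ, let (L,H) be a cover of G with |L(v)| = ⌈120Δ/ln Δ⌉ =: k for all v ∈ V(G), let p̂ := Δ^{-11/12}, and let p: V(H) → [0,p̂] satisfy: (1) |p(v) − 1| ≤ Δ^{-1/10} for each v ∈ V(G); (2) Q(v) ≥ ln k − (ln Δ)/40 for each v ∈ V(G); and (3) for each x ∈ V(H), either p(x) = 0 or p(x) ≥ 1/k. Then for each v ∈ V(G), p_m(v) ≥ 7/10 − ε. -/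
open Classical Finset Real

namespace Cover

variable {V W : Type} {G : SimpleGraph V}

open Classical in
/-- `p(v) = Σ_{x ∈ L(v)} p(x)`. -/
noncomputable def vertexWeight [Fintype W] (C : Cover G W) (p : W → ℝ) (v : V) : ℝ :=
  ∑ x : W, if C.toFun x = v then p x else 0

open Classical in
/-- The entropy `Q(v) = Σ_{x ∈ L(v)} p(x) ln(1/p(x))` (with `0·ln(1/0) = 0`, which holds
automatically since in Mathlib `1/0 = 0` and `Real.log 0 = 0`). -/
noncomputable def entropy [Fintype W] (C : Cover G W) (p : W → ℝ) (v : V) : ℝ :=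
  ∑ x : W, if C.toFun x = v then p x * Real.log (1 / p x) else 0

end Cover

namespace Cover

/-- The entropy is at most what one gets by bounding `ln (1 / p x)` by `K` on moderate colors and
by `ln (1 / p̂)` on the others. -/
theorem entropy_le_of_moderate_log_le {V W : Type} {G : SimpleGraph V} [Fintype W] (C : Cover G W)
    {p : W → ℝ} {phat K : ℝ} (hp0 : ∀ x, 0 ≤ p x) (hp1 : ∀ x, p x ≤ phat)
    (hK : ∀ x, 0 < p x → Real.log (1 / p x) ≤ K) (v : V) :
    C.entropy p v ≤ C.moderateVertexWeight p phat v * K +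
      (C.vertexWeight p v - C.moderateVertexWeight p phat v) * Real.log (1 / phat) := by
  unfold entropy moderateVertexWeight vertexWeight
  rw [← Finset.sum_sub_distrib, Finset.sum_mul, Finset.sum_mul, ← Finset.sum_add_distrib]
  refine Finset.sum_le_sum fun x _ => ?_
  by_cases hv : C.toFun x = v
  · by_cases hm : ModerateColor p phat x
    · simpa [hv, hm] using mul_le_mul_of_nonneg_left (hK x hm.1) hm.1.le
    · rcases (hp0 x).eq_or_lt with h | h
      · simp [← h]
      · have hx : p x = phat := le_antisymm (hp1 x) (not_lt.mp fun hlt => hm ⟨h, hlt⟩)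
        simp [hv, hm, hx]
  · simp [hv]

end Cover

/-- `ln D - ln ln D` is a lower bound for `ln ⌈c D / ln D⌉` when `c ≥ 1`. -/
theorem log_sub_log_log_le_log_ceil {c D : ℝ} (hc : 1 ≤ c) (hD : 1 < D) :
    Real.log D - Real.log (Real.log D) ≤ Real.log (⌈(c * D) / Real.log D⌉₊ : ℝ) := by
  have hL : 0 < Real.log D := Real.log_pos hD
  have hD0 : 0 < D := by linarith
  rw [← Real.log_div hD0.ne' hL.ne']
  refine Real.log_le_log (by positivity) (le_trans ?_ (Nat.le_ceil _))
  gcongr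
  nlinarith

/-- For large `n`, both `n ^ (-s)` and `ln ln n / ln n` are small. -/
theorem eventually_rpow_neg_le_and_log_log_le {s η : ℝ} (hs : 0 < s) (hη : 0 < η) :
    ∀ᶠ n : ℕ in Filter.atTop, 1 < n ∧ (n : ℝ) ^ (-s) ≤ η ∧
      Real.log (Real.log n) ≤ η * Real.log n := by
  have hn := tendsto_natCast_atTop_atTop (R := ℝ)
  have hlog := Real.tendsto_log_atTop.comp hn
  have hpow := (tendsto_rpow_neg_atTop hs).comp hn
  have hloglog := hlog.eventually (Real.isLittleO_log_id_atTop.bound hη)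
  filter_upwards [Filter.eventually_gt_atTop 1, hpow.eventually_le_const hη, hloglog]
    with n h1 h2 h3
  refine ⟨h1, h2, (le_abs_self _).trans (h3.trans_eq ?_)⟩
  have : 0 < Real.log n := Real.log_pos (by exact_mod_cast h1)
  simp [abs_of_pos this]

/-- **Lemma 5 (using the entropy).** For every `ε > 0` there is `Δ₀` such that for all
`Δ ≥ Δ₀`: if `G` is triangle-free with maximum degree at most `Δ`, `(L,H)` is a cover of
`G` with all lists of size exactly `k = ⌈120Δ/ln Δ⌉`, `p̂ = Δ^{-11/12}`,
`p : V(H) → [0, p̂]` satisfies `|p(v) − 1| ≤ Δ^{-1/10}` and `Q(v) ≥ ln k − (ln Δ)/40` for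
every vertex `v`, and every color `x` has `p(x) = 0` or `p(x) ≥ 1/k`, then
`p_m(v) ≥ 7/10 − ε` for every vertex `v`. -/
theorem moderateVertexWeight_ge_of_entropy :
    ∀ ε : ℝ, 0 < ε → ∃ Δ₀ : ℕ, ∀ Δ : ℕ, Δ₀ ≤ Δ →
      ∀ (V W : Type) [Fintype V] [Fintype W] (G : SimpleGraph V) [DecidableRel G.Adj]
        (C : Cover G W) (p : W → ℝ),
        G.CliqueFree 3 → G.maxDegree ≤ Δ →
        (∀ v : V, Fintype.card {x : W // C.toFun x = v} = ⌈(120 * Δ : ℝ) / Real.log Δ⌉₊) →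
        (∀ x : W, 0 ≤ p x ∧ p x ≤ (Δ : ℝ) ^ (-(11 / 12 : ℝ))) →
        (∀ v : V, |C.vertexWeight p v - 1| ≤ (Δ : ℝ) ^ (-(1 / 10 : ℝ))) →
        (∀ v : V, Real.log (⌈(120 * Δ : ℝ) / Real.log Δ⌉₊ : ℝ) - Real.log Δ / 40
            ≤ C.entropy p v) →
        (∀ x : W, p x = 0 ∨ 1 / (⌈(120 * Δ : ℝ) / Real.log Δ⌉₊ : ℝ) ≤ p x) →
        ∀ v : V, 7 / 10 - ε ≤ C.moderateVertexWeight p ((Δ : ℝ) ^ (-(11 / 12 : ℝ))) v := by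
  intro ε hε
  set η : ℝ := ε / (24 * (1 + ε)) with hη
  have hη0 : 0 < η := by positivity
  have hηε : η * (1 + ε) = ε / 24 := by rw [hη]; field_simp
  obtain ⟨N, hN⟩ := Filter.eventually_atTop.mp
    (eventually_rpow_neg_le_and_log_log_le (s := 1 / 10) (by norm_num) hη0)
  refine ⟨N, fun Δ hΔ V W _ _ G _ C p _ _ _ hp hw hQ hk v => ?_⟩
  obtain ⟨h1, hδ, hll⟩ := hN Δ hΔ
  have hD : (1 : ℝ) < Δ := by exact_mod_cast h1
  have hL : 0 < Real.log Δ := Real.log_pos hD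
  have hK := log_sub_log_log_le_log_ceil (c := 120) (by norm_num) hD
  have hkpos : (0 : ℝ) < ⌈(120 * Δ : ℝ) / Real.log Δ⌉₊ := by
    have : 0 < (120 * Δ : ℝ) / Real.log Δ := by positivity
    exact_mod_cast Nat.ceil_pos.mpr this
  have hent := C.entropy_le_of_moderate_log_le (fun x => (hp x).1) (fun x => (hp x).2)
    (K := Real.log (⌈(120 * Δ : ℝ) / Real.log Δ⌉₊ : ℝ)) (fun x hx => by
      refine Real.log_le_log (by positivity) ?_
      rw [one_div_le hx hkpos]
      exact (hk x).resolve_left hx.ne') v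
  have hphat : Real.log (1 / (Δ : ℝ) ^ (-(11 / 12 : ℝ))) = 11 / 12 * Real.log Δ := by
    rw [one_div, Real.log_inv, Real.log_rpow (by linarith)]
    ring
  rw [hphat] at hent
  have hQv := hQ v
  have hwv : C.vertexWeight p v ≤ 1 + η := by linarith [(abs_le.mp (hw v)).2]
  generalize C.vertexWeight p v = w at *
  generalize C.moderateVertexWeight p _ v = m at *
  generalize Real.log (⌈(120 * Δ : ℝ) / Real.log Δ⌉₊ : ℝ) = K at *
  generalize Real.log Δ = L at *
  have hη24 : η < 1 / 24 := by nlinarith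
  have hgap : (1 / 12 - η) * L ≤ K - 11 / 12 * L := by linarith
  have hgap0 : 0 < K - 11 / 12 * L := lt_of_lt_of_le (mul_pos (by linarith) hL) hgap
  have hwL : w * L ≤ (1 + η) * L := mul_le_mul_of_nonneg_right hwv hL.le
  refine le_of_mul_le_mul_right ?_ hgap0
  have hm : (K - 11 / 12 * L) - (1 / 40 + 11 / 12 * η) * L ≤ m * (K - 11 / 12 * L) := by
    linarith
  have hcoef : 1 / 40 + 11 / 12 * η ≤ (3 / 10 + ε) * (1 / 12 - η) := by nlinarith [mul_pos hε hη0]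
  have hcoefL := mul_le_mul_of_nonneg_right hcoef hL.le
  have hgapε := mul_le_mul_of_nonneg_left hgap (by positivity : 0 ≤ 3 / 10 + ε)
  linarith
end

section
/- There exists Δ₀ such that the following holds for all Δ ≥ Δ₀. Let G be a finite simple triangle-free graph with maximum degree at most Δ, let (L,H) be a cover of G with |L(v)| = ⌈120Δ/ln Δ⌉ =: k for all v ∈ V(G), let p̂ := Δ^{-11/12}, and let p: V(H) → [0,p̂] satisfy: (1) |p(v) − 1| ≤ Δ^{-1/10} for each v ∈ V(G); (2) p(uv) ≤ √2·k^{-1} for each uv ∈ E(G); (3) Q(v) ≥ ln k − (ln Δ)/40 for each v ∈ V(G); and (4) for each x ∈ V(H), either p(x) = 0 or p(x) ≥ 1/k. Then there exists a reduct (G',L',H',p') of (G,L,H,p) such that: (1) |p'(v) − p(v)| ≤ Δ^{-1/6} for each v ∈ V(G'); (2) p'(uv) ≤ p(uv) + k^{-1}Δ^{-1/3} for each uv ∈ E(G'); (3) Q'(v) ≥ Q(v) − 2·deg_G(v)/(k·ln Δ) − ln Δ·Δ^{-1/6} for each v ∈ V(G'); (4) deg_{G'}(v) ≤ deg_G(v)·(1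 − 2/(3 ln Δ)) + Δ^{2/3} for each v ∈ V(G'); and (5) for each x ∈ V(H'), either p'(x) = 0 or p'(x) ≥ 1/k. -/
open Classical Finset Real

namespace Cover

variable {V W : Type} {G : SimpleGraph V}

open Classical in
/-- `p(uv) = Σ p(x)p(y)`, the sum over edges `xy` of `H` with `x ∈ L(u)`, `y ∈ L(v)`. -/
noncomputable def edgeWeight [Fintype W] (C : Cover G W) (p : W → ℝ) (u v : V) : ℝ :=
  ∑ x : W, ∑ y : W,
    if C.toFun x = u ∧ C.toFun y = v ∧ C.graph.Adj x y then p x * p y else 0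

/-- `I` is a coloring of the subgraph of `G` induced by `A`, with respect to the induced
cover: `I` uses only colors lying over `A`, is independent in `H`, and meets the list of
every vertex of `A`. -/
def IsColoringOn (C : Cover G W) (A : Set V) (I : Set W) : Prop :=
  (∀ x ∈ I, C.toFun x ∈ A) ∧
    (∀ ⦃x⦄, x ∈ I → ∀ ⦃y⦄, y ∈ I → ¬ C.graph.Adj x y) ∧
    ∀ v ∈ A, ∃ x ∈ I, C.toFun x = v

/-- `(G'', L'', H'', p'')` is a reduct of `(G', L', H', p')`, where `G'`, `G''` are the
subgraphs of `G` induced by `A'`, `A''` and `L'`, `H'`, `L''`, `H''` are the induced covers: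
`A'' ⊆ A'`, the weight `p''` takes values in `[0, p̂]` on colors over `A''`, and every
`p''`-moderate coloring of `G''` extends to a `p'`-moderate coloring of `G'`. -/
def IsReductOn (C : Cover G W) (phat : ℝ) (A' : Set V) (p' : W → ℝ)
    (A'' : Set V) (p'' : W → ℝ) : Prop :=
  A'' ⊆ A' ∧
    (∀ x : W, C.toFun x ∈ A'' → 0 ≤ p'' x ∧ p'' x ≤ phat) ∧
    ∀ I : Set W, C.IsColoringOn A'' I → (∀ x ∈ I, 0 < p'' x ∧ p'' x < phat) →
      ∃ J : Set W, C.IsColoringOn A' J ∧ I ⊆ J ∧ ∀ x ∈ J, 0 < p' x ∧ p' x < phat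

end Cover

section ProductSpace

open MeasureTheory ProbabilityTheory

lemma DependsOn.finset_sum {ι J : Type} {s : Finset J} {f : J → (ι → Bool) → ℝ}
    {T : J → Set ι} (hf : ∀ j ∈ s, DependsOn (f j) (T j)) :
    DependsOn (fun ω ↦ ∑ j ∈ s, f j ω) (⋃ j ∈ s, T j) := fun x y h ↦
  Finset.sum_congr rfl fun j hj ↦ hf j hj fun i hi ↦ h i (by simp; exact ⟨j, hj, hi⟩)

lemma integral_ite_const {Ω : Type} [MeasurableSpace Ω] [DiscreteMeasurableSpace Ω]
    (μ : Measure Ω) (P : Ω → Prop) [DecidablePred P] (c : ℝ) :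
    ∫ ω, (if P ω then c else 0) ∂μ = μ.real {ω | P ω} * c := by
  have h := integral_indicator_const (μ := μ) c (MeasurableSet.of_discrete (s := {ω | P ω}))
  simpa [Set.indicator_apply] using h

variable {ι : Type} [Fintype ι] {ν : ι → Measure Bool} [∀ i, IsProbabilityMeasure (ν i)]

/-- Functions of disjoint sets of coordinates of a product space are independent. -/
lemma indepFun_of_dependsOn {β γ : Type} [MeasurableSpace β] [MeasurableSpace γ]
    [Nonempty β] [Nonempty γ] {f : (ι → Bool) → β} {g : (ι → Bool) → γ} {S T : Set ι}
    (hf : DependsOn f S) (hg : DependsOn g T) (hST : Disjoint S T) :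
    IndepFun f g (Measure.pi ν) := by
  obtain ⟨f', rfl⟩ := dependsOn_iff_exists_comp.1 hf
  obtain ⟨g', rfl⟩ := dependsOn_iff_exists_comp.1 hg
  have h := (iIndepFun_pi (μ := ν) (X := fun _ b ↦ b)
    (fun i ↦ aemeasurable_id)).indepFun_finset S.toFinset T.toFinset
      (by simpa using hST) (fun i ↦ measurable_pi_apply i)
  have h' := h.comp
    (φ := fun a ↦ f' fun i ↦ a ⟨i.1, by simp⟩)
    (ψ := fun a ↦ g' fun i ↦ a ⟨i.1, by simp⟩)
    .of_discrete .of_discrete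
  exact h'

lemma measureReal_inter_of_dependsOn {P Q : (ι → Bool) → Prop} {S T : Set ι}
    (hP : DependsOn P S) (hQ : DependsOn Q T) (hST : Disjoint S T) :
    (Measure.pi ν).real {ω | P ω ∧ Q ω} =
      (Measure.pi ν).real {ω | P ω} * (Measure.pi ν).real {ω | Q ω} := by
  have h := (indepFun_of_dependsOn (ν := ν) hP hQ hST).measure_inter_preimage_eq_mul
    {True} {True} .of_discrete .of_discrete
  have hP' : P ⁻¹' {True} = {ω | P ω} := by ext; simp
  have hQ' : Q ⁻¹' {True} = {ω | Q ω} := by ext; simp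
  rw [hP', hQ'] at h
  rw [measureReal_def, measureReal_def, measureReal_def, ← ENNReal.toReal_mul, ← h]
  rfl

lemma integral_mul_of_dependsOn {f g : (ι → Bool) → ℝ} {S T : Set ι}
    (hf : DependsOn f S) (hg : DependsOn g T) (hST : Disjoint S T) :
    ∫ ω, f ω * g ω ∂(Measure.pi ν) =
      (∫ ω, f ω ∂(Measure.pi ν)) * ∫ ω, g ω ∂(Measure.pi ν) :=
  (indepFun_of_dependsOn hf hg hST).integral_fun_mul_eq_mul_integral
    Measurable.of_discrete.aestronglyMeasurable Measurable.of_discrete.aestronglyMeasurable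

lemma hasSubgaussianMGF_sum_of_dependsOn {J : Type} {s : Finset J} {f : J → (ι → Bool) → ℝ}
    {T : J → Set ι} (hf : ∀ j ∈ s, DependsOn (f j) (T j))
    (hT : ∀ i ∈ s, ∀ j ∈ s, i ≠ j → Disjoint (T i) (T j)) {b : ℝ}
    (hb : ∀ j ∈ s, ∀ ω, f j ω ∈ Set.Icc 0 b) :
    HasSubgaussianMGF (fun ω ↦ ∑ j ∈ s, (f j ω - ∫ ω', f j ω' ∂(Measure.pi ν)))
      (#s * (‖b‖₊ / 2) ^ 2) (Measure.pi ν) := by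
  induction s using Finset.induction_on with
  | empty => simp
  | insert a s ha ih =>
    have h1 : HasSubgaussianMGF (fun ω ↦ f a ω - ∫ ω', f a ω' ∂(Measure.pi ν))
        ((‖b‖₊ / 2) ^ 2) (Measure.pi ν) := by
      simpa using hasSubgaussianMGF_of_mem_Icc (μ := Measure.pi ν) (X := f a)
        (Measurable.of_discrete.aemeasurable)
        (.of_forall (hb a (by simp)))
    have h2 := ih (fun j hj ↦ hf j (by simp [hj]))
      (fun i hi j hj ↦ hT i (by simp [hi]) j (by simp [hj])) (fun j hj ↦ hb j (by simp [hj]))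
    have h3 : IndepFun (fun ω ↦ f a ω - ∫ ω', f a ω' ∂(Measure.pi ν))
        (fun ω ↦ ∑ j ∈ s, (f j ω - ∫ ω', f j ω' ∂(Measure.pi ν))) (Measure.pi ν) := by
      refine indepFun_of_dependsOn (S := T a) (T := ⋃ j ∈ s, T j) ?_ ?_ ?_
      · intro x y h
        simp only [hf a (by simp) h]
      · refine DependsOn.finset_sum (f := fun j ω ↦ f j ω - ∫ ω', f j ω' ∂(Measure.pi ν)) ?_
        intro j hj x y h
        simp only [hf j (by simp [hj]) h]
      · simp only [Set.disjoint_iUnion_right]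
        intro j hj
        exact hT a (by simp) j (by simp [hj]) (by rintro rfl; exact ha hj)
    have h4 := h1.add_of_indepFun h2 h3
    convert h4 using 1
    · ext ω
      simp [Finset.sum_insert ha]
    · rw [Finset.card_insert_of_notMem ha]
      push_cast
      ring

/-- Hoeffding's inequality for sums of functions of disjoint sets of coordinates. -/
lemma measureReal_sum_ge_le_of_dependsOn {J : Type} {s : Finset J} {f : J → (ι → Bool) → ℝ}
    {T : J → Set ι} (hf : ∀ j ∈ s, DependsOn (f j) (T j))
    (hT : ∀ i ∈ s, ∀ j ∈ s, i ≠ j → Disjoint (T i) (T j)) {b n t : ℝ}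
    (hb : ∀ j ∈ s, ∀ ω, f j ω ∈ Set.Icc 0 b) (hb0 : 0 < b) (hs : (#s : ℝ) ≤ n)
    (ht : 0 ≤ t) :
    (Measure.pi ν).real {ω | ∑ j ∈ s, ∫ ω', f j ω' ∂(Measure.pi ν) + t ≤ ∑ j ∈ s, f j ω}
      ≤ exp (-(2 * t ^ 2 / (n * b ^ 2))) := by
  rcases s.eq_empty_or_nonempty with rfl | hne
  · rcases ht.eq_or_lt with rfl | ht
    · simp
    · simp [not_le.2 ht, exp_nonneg]
  have h := (hasSubgaussianMGF_sum_of_dependsOn (ν := ν) hf hT hb).measure_ge_le ht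
  have hs0 : (0 : ℝ) < #s := by exact_mod_cast hne.card_pos
  refine le_trans (le_of_eq ?_) (h.trans (exp_le_exp.2 ?_))
  · congr 1
    ext ω
    simp only [Set.mem_ofPred_eq, Finset.sum_sub_distrib]
    constructor <;> intro h <;> linarith
  · push_cast
    rw [Real.norm_of_nonneg hb0.le, neg_div, neg_le_neg_iff,
      show t ^ 2 / (2 * ((#s : ℝ) * (b / 2) ^ 2)) = 2 * t ^ 2 / (#s * b ^ 2) by
        field_simp]
    gcongr

lemma measureReal_sum_le_le_of_dependsOn {J : Type} {s : Finset J} {f : J → (ι → Bool) → ℝ}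
    {T : J → Set ι} (hf : ∀ j ∈ s, DependsOn (f j) (T j))
    (hT : ∀ i ∈ s, ∀ j ∈ s, i ≠ j → Disjoint (T i) (T j)) {b n t : ℝ}
    (hb : ∀ j ∈ s, ∀ ω, f j ω ∈ Set.Icc 0 b) (hb0 : 0 < b) (hs : (#s : ℝ) ≤ n)
    (ht : 0 ≤ t) :
    (Measure.pi ν).real {ω | ∑ j ∈ s, f j ω + t ≤ ∑ j ∈ s, ∫ ω', f j ω' ∂(Measure.pi ν)}
      ≤ exp (-(2 * t ^ 2 / (n * b ^ 2))) := by
  have h := measureReal_sum_ge_le_of_dependsOn (ν := ν) (s := s)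
    (f := fun j ω ↦ b - f j ω) (T := T) (b := b) (n := n) (t := t)
    (fun j hj x y h ↦ by simp only [hf j hj h]) hT
    (fun j hj ω ↦ ⟨by linarith [(hb j hj ω).2], by linarith [(hb j hj ω).1]⟩) hb0 hs ht
  refine le_trans (le_of_eq ?_) h
  congr 1
  ext ω
  have (j : J) : ∫ ω', (b - f j ω') ∂(Measure.pi ν) = b - ∫ ω', f j ω' ∂(Measure.pi ν) := by
    rw [integral_sub .of_finite .of_finite]
    simp
  simp only [Set.mem_ofPred_eq, this, Finset.sum_sub_distrib]
  constructor <;> intro h <;> linarith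

lemma measureReal_forall_eq_false (F : Finset ι) :
    (Measure.pi ν).real {ω | ∀ i ∈ F, ω i = false} = ∏ i ∈ F, (ν i).real {false} := by
  have : {ω : ι → Bool | ∀ i ∈ F, ω i = false} =
      Set.univ.pi fun i ↦ if i ∈ F then {false} else Set.univ := by
    ext ω
    simp only [Set.mem_ofPred_eq, Set.mem_pi, Set.mem_univ, true_implies]
    refine forall_congr' fun i ↦ ?_
    by_cases hi : i ∈ F <;> simp [hi]
  rw [this, measureReal_def, Measure.pi_pi, ENNReal.toReal_prod,
    ← Finset.prod_subset (Finset.subset_univ F)]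
  · exact Finset.prod_congr rfl fun i hi ↦ by rw [if_pos hi, measureReal_def]
  · intro i _ hi
    rw [if_neg hi, measure_univ, ENNReal.toReal_one]

lemma measureReal_eq_true (i : ι) :
    (Measure.pi ν).real {ω | ω i = true} = 1 - (ν i).real {false} := by
  have h := measureReal_forall_eq_false (ν := ν) {i}
  simp only [Finset.mem_singleton, forall_eq, Finset.prod_singleton] at h
  rw [← h, ← probReal_compl_eq_one_sub .of_discrete]
  congr 1
  ext ω
  simp

/-- The point agreeing with `ω` on `S` and with `ω'` off `S`. -/
noncomputable def glue (S : Set ι) (ω ω' : ι → Bool) : ι → Bool :=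
  fun i ↦ if i ∈ S then ω i else ω' i

lemma measurePreserving_glue (S : Set ι) :
    MeasurePreserving (fun z : (ι → Bool) × (ι → Bool) ↦ glue S z.1 z.2)
      ((Measure.pi ν).prod (Measure.pi ν)) (Measure.pi ν) := by
  refine ⟨.of_discrete, (Measure.pi_eq fun s hs ↦ ?_).symm⟩
  rw [Measure.map_apply .of_discrete .of_discrete]
  have : (fun z : (ι → Bool) × (ι → Bool) ↦ glue S z.1 z.2) ⁻¹' Set.univ.pi s =
      (Set.univ.pi fun i ↦ if i ∈ S then s i else Set.univ) ×ˢ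
        (Set.univ.pi fun i ↦ if i ∈ S then Set.univ else s i) := by
    ext z
    simp only [glue, Set.mem_preimage, Set.mem_pi, Set.mem_univ, true_implies, Set.mem_prod,
      ← forall_and]
    refine forall_congr' fun i ↦ ?_
    by_cases hi : i ∈ S <;> simp [hi]
  rw [this, Measure.prod_prod, Measure.pi_pi, Measure.pi_pi, ← Finset.prod_mul_distrib]
  refine Finset.prod_congr rfl fun i _ ↦ ?_
  by_cases hi : i ∈ S
  · rw [if_pos hi, if_pos hi, measure_univ, mul_one]
  · rw [if_neg hi, if_neg hi, measure_univ, one_mul]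

/-- If the conditional probability of `P`, given the coordinates outside `S`, is always at most
`δ`, then so is the probability of `P`. -/
lemma measureReal_le_of_forall_glue (S : Set ι) {P : (ι → Bool) → Prop} {δ : ℝ}
    (h : ∀ ω', (Measure.pi ν).real {ω | P (glue S ω ω')} ≤ δ) :
    (Measure.pi ν).real {ω | P ω} ≤ δ := by
  have h0 : 0 ≤ δ := measureReal_nonneg.trans (h fun _ ↦ true)
  refine ENNReal.toReal_le_of_le_ofReal h0 ?_
  rw [← (measurePreserving_glue (ν := ν) S).measure_preimage
    MeasurableSet.of_discrete.nullMeasurableSet, Measure.prod_apply_symm .of_discrete]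
  calc _ ≤ ∫⁻ _, ENNReal.ofReal δ ∂(Measure.pi ν) := lintegral_mono fun ω' ↦ by
        rw [← ENNReal.ofReal_toReal (measure_ne_top (Measure.pi ν) _)]
        exact ENNReal.ofReal_le_ofReal (h ω')
    _ = _ := by simp

/-- The symmetric Lovász local lemma for events on a product space. -/
lemma exists_forall_not_of_dependsOn {V : Type} [Fintype V] {B : V → (ι → Bool) → Prop}
    {S : V → Set ι} (hB : ∀ v, DependsOn (B v) (S v)) {N : V → Finset V}
    (hN : ∀ v w, w ∉ N v → Disjoint (S v) (S w)) {d q : ℝ} (hd : ∀ v, (#(N v) : ℝ) ≤ d)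
    (hq : ∀ v, (Measure.pi ν).real {ω | B v ω} ≤ q) (hq4 : 4 * q * d ≤ 1) (hq0 : 4 * q ≤ 1) :
    ∃ ω, ∀ v, ¬ B v ω := by
  set μ := Measure.pi ν
  have hsplit (v : V) (P : (ι → Bool) → Prop) :
      μ.real {ω | P ω} = μ.real {ω | B v ω ∧ P ω} + μ.real {ω | ¬ B v ω ∧ P ω} := by
    rw [← measureReal_inter_add_sdiff (s := {ω | P ω}) (t := {ω | B v ω}) .of_discrete]
    congr 2 <;> ext ω <;> simp [and_comm]
  have key : ∀ n : ℕ, ∀ T : Finset V, #T = n →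
      ∀ v, μ.real {ω | B v ω ∧ ∀ w ∈ T, ¬ B w ω} ≤ 2 * q * μ.real {ω | ∀ w ∈ T, ¬ B w ω} := by
    intro n
    induction n using Nat.strong_induction_on with
    | _ n ih =>
    intro T hT v
    have hq' : 0 ≤ q := measureReal_nonneg.trans (hq v)
    set T2 := T \ N v with hT2
    have hind : μ.real {ω | B v ω ∧ ∀ w ∈ T2, ¬ B w ω} ≤ q * μ.real {ω | ∀ w ∈ T2, ¬ B w ω} := by
      have := measureReal_inter_of_dependsOn (ν := ν) (P := B v)
        (Q := fun ω ↦ ∀ w ∈ T2, ¬ B w ω) (S := S v) (T := ⋃ w ∈ T2, S w) (hB v) ?_ ?_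
      · rw [this]
        gcongr
        exact hq v
      · intro x y h
        simp only [eq_iff_iff]
        refine forall₂_congr fun w hw ↦ ?_
        rw [hB w fun i hi ↦ h i (by simp only [Set.mem_iUnion]; exact ⟨w, hw, hi⟩)]
      · simp only [Set.disjoint_iUnion_right]
        exact fun w hw ↦ hN v w (by simp [hT2] at hw; exact hw.2)
    have hmono : μ.real {ω | B v ω ∧ ∀ w ∈ T, ¬ B w ω} ≤
        μ.real {ω | B v ω ∧ ∀ w ∈ T2, ¬ B w ω} :=
      measureReal_mono fun ω h ↦ ⟨h.1, fun w hw ↦ h.2 w (by simp [hT2] at hw; exact hw.1)⟩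
    have hhalf : μ.real {ω | ∀ w ∈ T2, ¬ B w ω} ≤ 2 * μ.real {ω | ∀ w ∈ T, ¬ B w ω} := by
      by_cases hlt : #T2 < #T
      · have hunion : {ω | ∀ w ∈ T2, ¬ B w ω} ⊆ {ω | ∀ w ∈ T, ¬ B w ω} ∪
            ⋃ w ∈ N v, {ω | B w ω ∧ ∀ w ∈ T2, ¬ B w ω} := by
          intro ω hω
          by_cases h : ∀ w ∈ T, ¬ B w ω
          · exact .inl h
          · push Not at h
            obtain ⟨w, hw, hBw⟩ := h
            refine .inr ?_
            simp only [Set.mem_iUnion]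
            refine ⟨w, ?_, hBw, hω⟩
            by_contra hwN
            exact hω w (by simp [hT2, hw, hwN]) hBw
        have h1 := (measureReal_mono (μ := μ) hunion).trans (measureReal_union_le _ _)
        have h2 := measureReal_biUnion_finset_le (μ := μ) (N v)
          (fun w ↦ {ω | B w ω ∧ ∀ w ∈ T2, ¬ B w ω})
        have h3 : ∑ w ∈ N v, μ.real {ω | B w ω ∧ ∀ w ∈ T2, ¬ B w ω} ≤
            #(N v) • (2 * q * μ.real {ω | ∀ w ∈ T2, ¬ B w ω}) :=
          Finset.sum_le_card_nsmul _ _ _ fun w _ ↦ ih #T2 (hT ▸ hlt) T2 rfl w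
        rw [nsmul_eq_mul] at h3
        have h4 : (#(N v) : ℝ) * (2 * q * μ.real {ω | ∀ w ∈ T2, ¬ B w ω}) ≤
            d * (2 * q * μ.real {ω | ∀ w ∈ T2, ¬ B w ω}) := by
          gcongr
          exact hd v
        have h5 : (4 * q * d) * μ.real {ω | ∀ w ∈ T2, ¬ B w ω} ≤
            1 * μ.real {ω | ∀ w ∈ T2, ¬ B w ω} := by gcongr
        linarith
      · have : T2 = T := Finset.eq_of_subset_of_card_le Finset.sdiff_subset (not_lt.1 hlt)
        rw [this]
        linarith [measureReal_nonneg (μ := μ) (s := {ω | ∀ w ∈ T, ¬ B w ω})]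
    calc _ ≤ _ := hmono
      _ ≤ _ := hind
      _ ≤ q * (2 * μ.real {ω | ∀ w ∈ T, ¬ B w ω}) := by gcongr
      _ = _ := by ring
  have hpos : ∀ T : Finset V, 0 < μ.real {ω | ∀ w ∈ T, ¬ B w ω} := by
    intro T
    induction T using Finset.induction_on with
    | empty => simp
    | insert v T hv ih =>
      have h1 := hsplit v fun ω ↦ ∀ w ∈ T, ¬ B w ω
      have h2 := key _ T rfl v
      have h3 : 2 * q * μ.real {ω | ∀ w ∈ T, ¬ B w ω} ≤
          1 / 2 * μ.real {ω | ∀ w ∈ T, ¬ B w ω} := by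
        gcongr
        linarith
      simp only [Finset.forall_mem_insert]
      linarith
  by_contra! hcon
  have := hpos Finset.univ
  have hempty : {ω | ∀ w ∈ (Finset.univ : Finset V), ¬ B w ω} = ∅ := by
    ext ω
    simpa using hcon ω
  rw [hempty] at this
  simp at this

end ProductSpace

lemma one_sub_sum_le_prod_one_sub {J : Type} {s : Finset J} {f : J → ℝ}
    (h0 : ∀ j ∈ s, 0 ≤ f j) (h1 : ∀ j ∈ s, f j ≤ 1) :
    1 - ∑ j ∈ s, f j ≤ ∏ j ∈ s, (1 - f j) := by
  induction s using Finset.induction_on with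
  | empty => simp
  | insert a s ha ih =>
    rw [Finset.sum_insert ha, Finset.prod_insert ha]
    have h2 := ih (fun j hj ↦ h0 j (by simp [hj])) (fun j hj ↦ h1 j (by simp [hj]))
    have h3 : 0 ≤ ∑ j ∈ s, f j := Finset.sum_nonneg fun j hj ↦ h0 j (by simp [hj])
    nlinarith [h0 a (by simp), h1 a (by simp)]

namespace Cover

open MeasureTheory ProbabilityTheory

variable {V W : Type} {G : SimpleGraph V}

/-- No neighbor of the color `x` is activated: `ω (inl y)` says that `y` is activated. -/
def Survives (C : Cover G W) (ω : W ⊕ W → Bool) (x : W) : Prop :=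
  ∀ y, C.graph.Adj x y → ω (.inl y) = false

/-- Some moderate color of `u` is activated and survives. -/
def IsColored (C : Cover G W) (p : W → ℝ) (phat : ℝ) (ω : W ⊕ W → Bool) (u : V) : Prop :=
  ∃ x, C.toFun x = u ∧ (0 < p x ∧ p x < phat) ∧ ω (.inl x) = true ∧ C.Survives ω x

/-- The set of coordinates that may influence the new weight of `x`. -/
def support (C : Cover G W) (x : W) : Set (W ⊕ W) :=
  insert (.inr x) (.inl '' {y | C.graph.Adj x y})

/-- The coordinates belonging to the colors of the vertices in `S`. -/
def coords (C : Cover G W) (S : Set V) : Set (W ⊕ W) :=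
  {i | C.toFun (i.elim id id) ∈ S}

/-- The coordinates of `ν` are Bernoulli measures: the color `x` is activated with probability
`α * p x`, and its auxiliary coin succeeds with probability `p x / phat`. -/
structure IsNibble (p : W → ℝ) (phat α : ℝ) (ν : W ⊕ W → Measure Bool) : Prop where
  p_nonneg : ∀ x, 0 ≤ p x
  p_le : ∀ x, p x ≤ phat
  phat_pos : 0 < phat
  α_nonneg : 0 ≤ α
  α_mul_le : α * phat ≤ 1 / 4
  real_inl : ∀ x, (ν (.inl x)).real {false} = 1 - α * p x
  real_inr : ∀ x, (ν (.inr x)).real {false} = 1 - p x / phat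

lemma IsNibble.α_mul_p_le {p : W → ℝ} {phat α : ℝ} {ν : W ⊕ W → Measure Bool}
    (h : IsNibble p phat α ν) (x : W) : α * p x ≤ 1 / 4 :=
  (mul_le_mul_of_nonneg_left (h.p_le x) h.α_nonneg).trans h.α_mul_le

lemma IsNibble.α_mul_p_nonneg {p : W → ℝ} {phat α : ℝ} {ν : W ⊕ W → Measure Bool}
    (h : IsNibble p phat α ν) (x : W) : 0 ≤ α * p x :=
  mul_nonneg h.α_nonneg (h.p_nonneg x)

section Dependence

variable {C : Cover G W}

lemma Survives.congr {ω ω' : W ⊕ W → Bool} {x : W}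
    (h : ∀ y, C.graph.Adj x y → ω (.inl y) = ω' (.inl y)) :
    C.Survives ω x ↔ C.Survives ω' x :=
  forall₂_congr fun y hy ↦ by rw [h y hy]

lemma disjoint_support (hG : G.CliqueFree 3) {x y : W} (hxy : x ≠ y)
    (h : C.toFun x = C.toFun y ∨ G.Adj (C.toFun x) (C.toFun y)) :
    Disjoint (C.support x) (C.support y) := by
  rw [Set.disjoint_left]
  rintro i (rfl | ⟨a, ha, rfl⟩) (hb | ⟨b, hb, hab⟩)
  · exact hxy (Sum.inr_injective hb)
  · cases hab
  · cases hb
  · obtain rfl := Sum.inl_injective hab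
    rcases h with h | h
    · exact hxy (C.matching ha.symm hb.symm h)
    · exact hG {C.toFun x, C.toFun y, C.toFun b}
        (SimpleGraph.is3Clique_triple_iff.2 ⟨h, C.adj_map ha, C.adj_map hb⟩)

lemma support_subset (x : W) :
    C.support x ⊆ C.coords (insert (C.toFun x) (G.neighborSet (C.toFun x))) := by
  rintro i (rfl | ⟨y, hy, rfl⟩)
  · simp [coords]
  · exact .inr (C.adj_map hy)

end Dependence

variable [Fintype W]

/-- The list of `v` as a finite set. -/
noncomputable def list (C : Cover G W) (v : V) : Finset W :=
  {x | C.toFun x = v}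

/-- The edges of the cover graph between the lists of `u` and `v`. -/
noncomputable def edges (C : Cover G W) (u v : V) : Finset (W × W) :=
  {e | C.toFun e.1 = u ∧ C.toFun e.2 = v ∧ C.graph.Adj e.1 e.2}

/-- The probability that the color `x` survives. -/
noncomputable def keep (C : Cover G W) (ν : W ⊕ W → Measure Bool) (x : W) : ℝ :=
  (Measure.pi ν).real {ω | C.Survives ω x}

/-- The random new weight of a color. -/
noncomputable def newWeight (C : Cover G W) (p : W → ℝ) (phat : ℝ) (ν : W ⊕ W → Measure Bool)
    (ω : W ⊕ W → Bool) (x : W) : ℝ :=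
  if p x ≤ phat * C.keep ν x then (if C.Survives ω x then p x / C.keep ν x else 0)
  else (if ω (.inr x) = true then phat else 0)

@[simp] lemma mem_list {C : Cover G W} {v : V} {x : W} : x ∈ C.list v ↔ C.toFun x = v := by
  simp [list]

@[simp] lemma mem_edges {C : Cover G W} {u v : V} {e : W × W} :
    e ∈ C.edges u v ↔ C.toFun e.1 = u ∧ C.toFun e.2 = v ∧ C.graph.Adj e.1 e.2 := by
  simp [edges]

lemma vertexWeight_eq_sum (C : Cover G W) (p : W → ℝ) (v : V) :
    C.vertexWeight p v = ∑ x ∈ C.list v, p x := by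
  rw [vertexWeight, list, Finset.sum_filter]

lemma entropy_eq_sum (C : Cover G W) (p : W → ℝ) (v : V) :
    C.entropy p v = ∑ x ∈ C.list v, p x * Real.log (1 / p x) := by
  rw [entropy, list, Finset.sum_filter]

lemma edgeWeight_eq_sum (C : Cover G W) (p : W → ℝ) (u v : V) :
    C.edgeWeight p u v = ∑ e ∈ C.edges u v, p e.1 * p e.2 := by
  rw [edgeWeight, edges, Finset.sum_filter, Fintype.sum_prod_type]

lemma card_edges_le (C : Cover G W) (u v : V) : #(C.edges u v) ≤ #(C.list u) := by
  refine Finset.card_le_card_of_injOn Prod.fst (fun e he ↦ ?_) ?_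
  · simp at he
    simp [he.1]
  · rintro ⟨x, y⟩ h ⟨x', y'⟩ h' hxx
    simp at h h' hxx
    subst hxx
    rw [C.matching h.2.2 h'.2.2 (h.2.1.trans h'.2.1.symm)]

lemma sum_mul_sum_adj (C : Cover G W) (p : W → ℝ) (v : V) [Fintype V] [DecidableRel G.Adj] :
    ∑ x ∈ C.list v, p x * ∑ y with C.graph.Adj x y, p y =
      ∑ u ∈ G.neighborFinset v, C.edgeWeight p v u := by
  simp only [edgeWeight, Finset.mul_sum, list, Finset.sum_filter]
  rw [Finset.sum_comm]
  refine Finset.sum_congr rfl fun x _ ↦ ?_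
  rw [Finset.sum_comm]
  split_ifs with hx
  · refine Finset.sum_congr rfl fun y _ ↦ ?_
    by_cases hxy : C.graph.Adj x y
    · have : G.Adj v (C.toFun y) := hx ▸ C.adj_map hxy
      simp [hx, hxy, this]
    · simp [hxy]
  · simp [hx]

lemma dependsOn_newWeight {C : Cover G W} {p : W → ℝ} {phat : ℝ}
    {ν : W ⊕ W → Measure Bool} (x : W) :
    DependsOn (fun ω ↦ C.newWeight p phat ν ω x) (C.support x) := by
  intro ω ω' h
  have h1 : C.Survives ω x ↔ C.Survives ω' x :=
    Survives.congr fun y hy ↦ h _ (.inr ⟨y, hy, rfl⟩)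
  have h2 : ω (.inr x) = ω' (.inr x) := h _ (.inl rfl)
  simp only [newWeight, h1, h2]

namespace IsNibble

variable {C : Cover G W} {p : W → ℝ} {phat α : ℝ} {ν : W ⊕ W → Measure Bool}
  [∀ i, IsProbabilityMeasure (ν i)]

lemma keep_eq (h : IsNibble p phat α ν) (x : W) :
    C.keep ν x = ∏ y with C.graph.Adj x y, (1 - α * p y) := by
  have h1 := measureReal_forall_eq_false (ν := ν)
    (Finset.map ⟨Sum.inl, Sum.inl_injective⟩ ({y | C.graph.Adj x y} : Finset W))
  rw [Finset.prod_map] at h1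
  simp only [Function.Embedding.coeFn_mk, h.real_inl] at h1
  rw [← h1, keep]
  congr 1
  ext ω
  simp [Survives]

lemma keep_pos (h : IsNibble p phat α ν) (x : W) : 0 < C.keep ν x := by
  rw [h.keep_eq]
  exact Finset.prod_pos fun y _ ↦ by linarith [h.α_mul_p_le y]

lemma keep_le_one (x : W) : C.keep ν x ≤ 1 := measureReal_le_one

lemma one_sub_le_keep (h : IsNibble p phat α ν) (x : W) :
    1 - α * ∑ y with C.graph.Adj x y, p y ≤ C.keep ν x := by
  rw [h.keep_eq, Finset.mul_sum]
  exact one_sub_sum_le_prod_one_sub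
    (fun y _ ↦ h.α_mul_p_nonneg y) (fun y _ ↦ by linarith [h.α_mul_p_le y])

lemma log_inv_keep_le (h : IsNibble p phat α ν) (x : W) :
    -Real.log (C.keep ν x) ≤ √2 * α * ∑ y with C.graph.Adj x y, p y := by
  rw [h.keep_eq, Real.log_prod fun y _ ↦ by linarith [h.α_mul_p_le y], ← Finset.sum_neg_distrib,
    Finset.mul_sum]
  refine Finset.sum_le_sum fun y _ ↦ ?_
  have h1 := h.α_mul_p_le y
  have h2 := h.α_mul_p_nonneg y
  have h3 := Real.one_sub_inv_le_log_of_pos (x := 1 - α * p y) (by linarith)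
  have h4 : (4 / 3 : ℝ) ≤ √2 := Real.le_sqrt_of_sq_le (by norm_num)
  have h5 : (1 - α * p y)⁻¹ ≤ 1 + 4 / 3 * (α * p y) := by
    rw [inv_le_iff_one_le_mul₀ (by linarith)]
    nlinarith
  have h6 := mul_le_mul_of_nonneg_right h4 h2
  linarith

lemma newWeight_nonneg (h : IsNibble p phat α ν) (ω : W ⊕ W → Bool) (x : W) :
    0 ≤ C.newWeight p phat ν ω x := by
  have := h.p_nonneg x
  have := h.keep_pos (C := C) x
  have := h.phat_pos
  unfold newWeight
  split_ifs <;> positivity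

lemma newWeight_le (h : IsNibble p phat α ν) (ω : W ⊕ W → Bool) (x : W) :
    C.newWeight p phat ν ω x ≤ phat := by
  have := h.keep_pos (C := C) x
  have := h.phat_pos
  unfold newWeight
  split_ifs with h1
  · rwa [div_le_iff₀ ‹_›]
  all_goals linarith

lemma newWeight_eq_zero_or (h : IsNibble p phat α ν) {m : ℝ} (hm : m ≤ phat)
    (hp : ∀ x, p x = 0 ∨ m ≤ p x) (ω : W ⊕ W → Bool) (x : W) :
    C.newWeight p phat ν ω x = 0 ∨ m ≤ C.newWeight p phat ν ω x := by
  have h0 := h.keep_pos (C := C) x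
  have h1 := keep_le_one (C := C) (ν := ν) x
  unfold newWeight
  split_ifs
  · rcases hp x with hx | hx
    · simp [hx]
    · exact .inr (hx.trans (le_div_self (h.p_nonneg x) h0 h1))
  all_goals simp [hm]

lemma integral_newWeight (h : IsNibble p phat α ν) (x : W) :
    ∫ ω, C.newWeight p phat ν ω x ∂(Measure.pi ν) = p x := by
  have h0 := h.keep_pos (C := C) x
  have h1 := h.phat_pos
  unfold newWeight
  split_ifs
  · rw [integral_ite_const, ← keep]
    field_simp
  · rw [integral_ite_const, measureReal_eq_true, h.real_inr]
    field_simp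
    ring

lemma le_integral_newWeight_mul_log (h : IsNibble p phat α ν) (x : W) :
    p x * Real.log (1 / p x) - p x * (√2 * α * ∑ y with C.graph.Adj x y, p y) ≤
      ∫ ω, C.newWeight p phat ν ω x * Real.log (1 / C.newWeight p phat ν ω x)
        ∂(Measure.pi ν) := by
  have h0 := h.keep_pos (C := C) x
  have h1 := h.phat_pos
  rcases (h.p_nonneg x).eq_or_lt with hx | hx
  · have : ∀ ω, C.newWeight p phat ν ω x = 0 := fun ω ↦ by
      rw [newWeight, if_pos (by rw [← hx]; positivity), ← hx]
      simp
    simp [← hx, this]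
  have h2 := mul_le_mul_of_nonneg_left (h.log_inv_keep_le (C := C) x) hx.le
  unfold newWeight
  split_ifs with hle
  · have (ω : W ⊕ W → Bool) : (if C.Survives ω x then p x / C.keep ν x else 0) *
        Real.log (1 / if C.Survives ω x then p x / C.keep ν x else 0) =
        if C.Survives ω x then p x / C.keep ν x * Real.log (1 / (p x / C.keep ν x)) else 0 := by
      split_ifs <;> simp
    simp only [this]
    rw [integral_ite_const, ← keep, one_div_div, Real.log_div h0.ne' hx.ne', one_div, Real.log_inv]
    have : C.keep ν x * (p x / C.keep ν x * (Real.log (C.keep ν x) - Real.log (p x))) =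
      p x * (Real.log (C.keep ν x) - Real.log (p x)) := by field_simp
    linarith
  · have (ω : W ⊕ W → Bool) : (if ω (.inr x) = true then phat else 0) *
        Real.log (1 / if ω (.inr x) = true then phat else 0) =
        if ω (.inr x) = true then phat * Real.log (1 / phat) else 0 := by
      split_ifs <;> simp
    simp only [this]
    rw [integral_ite_const, measureReal_eq_true, h.real_inr, one_div, one_div, Real.log_inv,
      Real.log_inv]
    have h3 : (1 - (1 - p x / phat)) * (phat * -Real.log phat) = p x * -Real.log phat := by
      field_simp
      ring
    have h4 : Real.log phat + Real.log (C.keep ν x) ≤ Real.log (p x) := by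
      rw [← Real.log_mul h1.ne' h0.ne']
      exact Real.log_le_log (by positivity) (not_le.1 hle).le
    have h5 := mul_le_mul_of_nonneg_left h4 hx.le
    linarith

lemma newWeight_mul_log_mem_Icc (h : IsNibble p phat α ν) {m : ℝ} (hm0 : 0 < m)
    (hm : m ≤ phat) (hphat : phat ≤ 1) (hp : ∀ x, p x = 0 ∨ m ≤ p x)
    (ω : W ⊕ W → Bool) (x : W) :
    C.newWeight p phat ν ω x * Real.log (1 / C.newWeight p phat ν ω x) ∈
      Set.Icc 0 (phat * Real.log (1 / m)) := by
  have h1 := h.newWeight_le (C := C) ω x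
  have hlog : 0 ≤ Real.log (1 / m) := Real.log_nonneg (one_le_one_div hm0 (hm.trans hphat))
  rcases h.newWeight_eq_zero_or (C := C) hm hp ω x with h0 | h0
  · rw [h0]
    simpa using mul_nonneg h.phat_pos.le hlog
  · have hpos := hm0.trans_le h0
    refine ⟨mul_nonneg hpos.le (Real.log_nonneg (one_le_one_div hpos (h1.trans hphat))), ?_⟩
    exact mul_le_mul h1 (Real.log_le_log (by positivity) (one_div_le_one_div_of_le hm0 h0))
      (Real.log_nonneg (one_le_one_div hpos (h1.trans hphat))) h.phat_pos.le

lemma disjoint_support_of_mem_list (hG : G.CliqueFree 3) {v : V} :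
    ∀ x ∈ C.list v, ∀ y ∈ C.list v, x ≠ y → Disjoint (C.support x) (C.support y) :=
  fun _ hx _ hy hxy ↦ disjoint_support hG hxy (.inl (by simp_all))

variable {n : ℝ}

lemma prob_vertexWeight_ge (h : IsNibble p phat α ν) (hG : G.CliqueFree 3) {v : V}
    (hn : (#(C.list v) : ℝ) ≤ n) {t : ℝ} (ht : 0 ≤ t) :
    (Measure.pi ν).real {ω | C.vertexWeight p v + t ≤ C.vertexWeight (C.newWeight p phat ν ω) v} ≤
      exp (-(2 * t ^ 2 / (n * phat ^ 2))) := by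
  have := measureReal_sum_ge_le_of_dependsOn (ν := ν) (s := C.list v)
    (f := fun x ω ↦ C.newWeight p phat ν ω x) (fun x _ ↦ dependsOn_newWeight x)
    (disjoint_support_of_mem_list hG) (fun x _ ω ↦ ⟨h.newWeight_nonneg ω x, h.newWeight_le ω x⟩)
    h.phat_pos hn ht
  simpa only [h.integral_newWeight, vertexWeight_eq_sum] using this

lemma prob_vertexWeight_le (h : IsNibble p phat α ν) (hG : G.CliqueFree 3) {v : V}
    (hn : (#(C.list v) : ℝ) ≤ n) {t : ℝ} (ht : 0 ≤ t) :
    (Measure.pi ν).real {ω | C.vertexWeight (C.newWeight p phat ν ω) v + t ≤ C.vertexWeight p v} ≤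
      exp (-(2 * t ^ 2 / (n * phat ^ 2))) := by
  have := measureReal_sum_le_le_of_dependsOn (ν := ν) (s := C.list v)
    (f := fun x ω ↦ C.newWeight p phat ν ω x) (fun x _ ↦ dependsOn_newWeight x)
    (disjoint_support_of_mem_list hG) (fun x _ ω ↦ ⟨h.newWeight_nonneg ω x, h.newWeight_le ω x⟩)
    h.phat_pos hn ht
  simpa only [h.integral_newWeight, vertexWeight_eq_sum] using this

lemma prob_edgeWeight_ge (h : IsNibble p phat α ν) (hG : G.CliqueFree 3) {u v : V}
    (hn : (#(C.list u) : ℝ) ≤ n) {t : ℝ} (ht : 0 ≤ t) :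
    (Measure.pi ν).real {ω | C.edgeWeight p u v + t ≤ C.edgeWeight (C.newWeight p phat ν ω) u v} ≤
      exp (-(2 * t ^ 2 / (n * (phat ^ 2) ^ 2))) := by
  have hd : ∀ e ∈ C.edges u v, Disjoint (C.support e.1) (C.support e.2) := fun e he ↦
    disjoint_support hG (C.graph.ne_of_adj (mem_edges.1 he).2.2)
      (.inr (C.adj_map (mem_edges.1 he).2.2))
  have := measureReal_sum_ge_le_of_dependsOn (ν := ν) (s := C.edges u v)
    (f := fun e ω ↦ C.newWeight p phat ν ω e.1 * C.newWeight p phat ν ω e.2)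
    (T := fun e ↦ C.support e.1 ∪ C.support e.2) (b := phat ^ 2) (n := n) (t := t)
    (fun e _ ω ω' hω ↦ ?_) ?_ (fun e _ ω ↦ ⟨?_, ?_⟩) (pow_pos h.phat_pos 2)
    ((Nat.cast_le.2 (C.card_edges_le u v)).trans hn) ht
  · simp only [edgeWeight_eq_sum]
    rwa [Finset.sum_congr rfl fun e he ↦ integral_mul_of_dependsOn (dependsOn_newWeight e.1)
      (dependsOn_newWeight e.2) (hd e he), Finset.sum_congr rfl fun e _ ↦ by
        rw [h.integral_newWeight, h.integral_newWeight]] at this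
  · have h1 := dependsOn_newWeight (C := C) (p := p) (phat := phat) (ν := ν) e.1
      fun i hi ↦ hω i (.inl hi)
    have h2 := dependsOn_newWeight (C := C) (p := p) (phat := phat) (ν := ν) e.2
      fun i hi ↦ hω i (.inr hi)
    simp only at h1 h2 ⊢
    rw [h1, h2]
  · rintro ⟨x, y⟩ hxy ⟨x', y'⟩ hxy' hne
    simp only [mem_edges] at hxy hxy'
    have hx : x ≠ x' := by
      rintro rfl
      exact hne (by rw [C.matching hxy.2.2 hxy'.2.2 (hxy.2.1.trans hxy'.2.1.symm)])
    have hy : y ≠ y' := by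
      rintro rfl
      exact hne (by rw [C.matching hxy.2.2.symm hxy'.2.2.symm (hxy.1.trans hxy'.1.symm)])
    have huv : G.Adj u v := hxy.1 ▸ hxy.2.1 ▸ C.adj_map hxy.2.2
    have huv' := huv.ne
    simp only [Set.disjoint_union_left, Set.disjoint_union_right]
    refine ⟨⟨?_, ?_⟩, ?_, ?_⟩
    · exact disjoint_support hG hx (.inl (hxy.1.trans hxy'.1.symm))
    · refine disjoint_support hG ?_ (.inr (hxy.2.1 ▸ hxy'.1 ▸ huv.symm))
      rintro rfl
      exact huv' (hxy'.1.symm.trans hxy.2.1)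
    · refine disjoint_support hG ?_ (.inr (hxy.1 ▸ hxy'.2.1 ▸ huv))
      rintro rfl
      exact huv' (hxy.1.symm.trans hxy'.2.1)
    · exact disjoint_support hG hy (.inl (hxy.2.1.trans hxy'.2.1.symm))
  · exact mul_nonneg (h.newWeight_nonneg ω _) (h.newWeight_nonneg ω _)
  · rw [sq]
    exact mul_le_mul (h.newWeight_le ω _) (h.newWeight_le ω _) (h.newWeight_nonneg ω _)
      h.phat_pos.le

lemma prob_entropy_le (h : IsNibble p phat α ν) (hG : G.CliqueFree 3) {v : V}
    [Fintype V] [DecidableRel G.Adj]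
    (hn : (#(C.list v) : ℝ) ≤ n) {t m : ℝ} (ht : 0 ≤ t) (hm0 : 0 < m)
    (hm : m ≤ phat) (hphat : phat < 1) (hp : ∀ x, p x = 0 ∨ m ≤ p x) :
    (Measure.pi ν).real {ω | C.entropy (C.newWeight p phat ν ω) v + t ≤
      C.entropy p v - √2 * α * ∑ u ∈ G.neighborFinset v, C.edgeWeight p v u} ≤
      exp (-(2 * t ^ 2 / (n * (phat * Real.log (1 / m)) ^ 2))) := by
  have hlog : 0 < Real.log (1 / m) := Real.log_pos (one_lt_one_div hm0 (hm.trans_lt hphat))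
  have := measureReal_sum_le_le_of_dependsOn (ν := ν) (s := C.list v)
    (f := fun x ω ↦ C.newWeight p phat ν ω x * Real.log (1 / C.newWeight p phat ν ω x))
    (fun x _ ω ω' hω ↦ by
      have := dependsOn_newWeight (C := C) (p := p) (phat := phat) (ν := ν) x hω
      simp only at this ⊢
      rw [this])
    (disjoint_support_of_mem_list hG)
    (fun x _ ω ↦ h.newWeight_mul_log_mem_Icc hm0 hm hphat.le hp ω x)
    (mul_pos h.phat_pos hlog) hn ht
  refine le_trans (measureReal_mono fun ω hω ↦ ?_) this
  simp only [Set.mem_ofPred_eq, entropy_eq_sum, ← sum_mul_sum_adj] at hω ⊢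
  have h1 := Finset.sum_le_sum fun x (_ : x ∈ C.list v) ↦
    h.le_integral_newWeight_mul_log (C := C) x
  rw [Finset.sum_sub_distrib] at h1
  have h2 : ∑ x ∈ C.list v, p x * (√2 * α * ∑ y with C.graph.Adj x y, p y) =
      √2 * α * ∑ x ∈ C.list v, p x * ∑ y with C.graph.Adj x y, p y := by
    rw [Finset.mul_sum]
    exact Finset.sum_congr rfl fun _ _ ↦ by ring
  linarith

end IsNibble

/-- The total weight of the moderate colors of `v` that survive. -/
noncomputable def survivingWeight (C : Cover G W) (p : W → ℝ) (phat : ℝ) (ω : W ⊕ W → Bool)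
    (v : V) : ℝ :=
  ∑ x ∈ C.list v with 0 < p x ∧ p x < phat, if C.Survives ω x then p x else 0

namespace IsNibble

variable {C : Cover G W} {p : W → ℝ} {phat α : ℝ} {ν : W ⊕ W → Measure Bool}
  [∀ i, IsProbabilityMeasure (ν i)] {n : ℝ}

lemma prob_survivingWeight_le (h : IsNibble p phat α ν) (hG : G.CliqueFree 3) {v : V}
    (hn : (#(C.list v) : ℝ) ≤ n) {t : ℝ} (ht : 0 ≤ t) :
    (Measure.pi ν).real {ω | C.survivingWeight p phat ω v + t ≤
      ∑ x ∈ C.list v with 0 < p x ∧ p x < phat, C.keep ν x * p x} ≤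
      exp (-(2 * t ^ 2 / (n * phat ^ 2))) := by
  have := measureReal_sum_le_le_of_dependsOn (ν := ν)
    (s := {x ∈ C.list v | 0 < p x ∧ p x < phat})
    (f := fun x ω ↦ if C.Survives ω x then p x else 0) (T := C.support)
    (fun x _ ω ω' hω ↦ by
      have : C.Survives ω x ↔ C.Survives ω' x :=
        Survives.congr fun y hy ↦ hω _ (.inr ⟨y, hy, rfl⟩)
      simp only [this])
    (fun x hx y hy ↦ disjoint_support_of_mem_list hG x (Finset.mem_filter.1 hx).1 y
      (Finset.mem_filter.1 hy).1)
    (fun x _ ω ↦ by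
      have := h.p_nonneg x
      have := h.p_le x
      have := h.phat_pos
      split_ifs <;> constructor <;> linarith)
    h.phat_pos ((Nat.cast_le.2 (Finset.card_filter_le _ _)).trans hn) ht
  simpa only [integral_ite_const, survivingWeight, keep] using this

lemma prob_card_uncolored_ge (h : IsNibble p phat α ν) (hG : G.CliqueFree 3) {v : V}
    [Fintype V] [DecidableRel G.Adj] (hn : (G.degree v : ℝ) ≤ n) {t c r : ℝ} (ht : 0 ≤ t)
    (hr : exp (-(α * c)) ≤ r) :
    (Measure.pi ν).real {ω | (∀ u ∈ G.neighborFinset v, c ≤ C.survivingWeight p phat ω u) ∧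
      G.degree v * r + t ≤ #{u ∈ G.neighborFinset v | ¬ C.IsColored p phat ω u}} ≤
      exp (-(2 * t ^ 2 / n)) := by
  set S : Set (W ⊕ W) := .inl '' {x | G.Adj v (C.toFun x)} with hS
  refine measureReal_le_of_forall_glue S fun ω' ↦ ?_
  have hsurv : ∀ ω x, G.Adj v (C.toFun x) → (C.Survives (glue S ω ω') x ↔ C.Survives ω' x) := by
    intro ω x hx
    refine Survives.congr fun y hy ↦ if_neg ?_
    rintro ⟨z, hz, hzy⟩
    obtain rfl := Sum.inl_injective hzy
    exact hG {v, C.toFun x, C.toFun z}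
      (SimpleGraph.is3Clique_triple_iff.2 ⟨hx, hz, C.adj_map hy⟩)
  by_cases hc : ∀ u ∈ G.neighborFinset v, c ≤ C.survivingWeight p phat ω' u
  swap
  · push Not at hc
    obtain ⟨u, hu, huc⟩ := hc
    have : {ω | (∀ u ∈ G.neighborFinset v, c ≤ C.survivingWeight p phat (glue S ω ω') u) ∧
        G.degree v * r + t ≤ #{u ∈ G.neighborFinset v | ¬ C.IsColored p phat (glue S ω ω') u}} =
        ∅ := by
      ext ω
      simp only [Set.mem_ofPred_eq, Set.mem_empty_iff_false, iff_false]
      rintro ⟨h1, -⟩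
      refine (h1 u hu).not_gt (lt_of_eq_of_lt (Finset.sum_congr rfl fun x hx ↦ ?_) huc)
      simp only [Finset.mem_filter, mem_list] at hx
      simp only [hsurv ω x (by rw [hx.1]; simpa using hu)]
    rw [this, measureReal_empty]
    exact exp_nonneg _
  have huncol : ∀ u ∈ G.neighborFinset v, ∀ ω, ¬ C.IsColored p phat (glue S ω ω') u ↔
      ∀ i ∈ Finset.map ⟨Sum.inl, Sum.inl_injective⟩
        ({x ∈ {x ∈ C.list u | 0 < p x ∧ p x < phat} | C.Survives ω' x} : Finset W),
        ω i = false := by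
    intro u hu ω
    simp only [IsColored, not_exists, Finset.mem_map, Finset.mem_filter, mem_list,
      Function.Embedding.coeFn_mk, forall_exists_index, and_imp]
    have hu' : G.Adj v u := by simpa using hu
    constructor
    · rintro h1 i x rfl h2 h3 h4 rfl
      have := h1 x
      rw [hsurv ω x hu'] at this
      simpa [h2, h3, h4, glue, hS, hu'] using this
    · rintro h1 x ⟨rfl, ⟨h2, h3⟩, h4, h5⟩
      rw [hsurv ω x hu'] at h5
      have := h1 _ x rfl h2 h3 h5 rfl
      simp [glue, hS, hu', this] at h4
  have := measureReal_sum_ge_le_of_dependsOn (ν := ν) (s := G.neighborFinset v) (n := n) (t := t)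
    (f := fun u ω ↦ if ¬ C.IsColored p phat (glue S ω ω') u then (1 : ℝ) else 0)
    (T := fun u ↦ .inl '' {x | C.toFun x = u}) (b := 1)
    (fun u hu ω₁ ω₂ hω ↦ ?_) ?_ (fun u _ ω ↦ ?_) one_pos (by simpa using hn) ht
  · rw [one_pow, mul_one] at this
    refine le_trans (measureReal_mono fun ω hω ↦ ?_) this
    have h1 : ∑ u ∈ G.neighborFinset v, ∫ ω, (if ¬ C.IsColored p phat (glue S ω ω') u
        then (1 : ℝ) else 0) ∂(Measure.pi ν) ≤ G.degree v * r := by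
      rw [← G.card_neighborFinset_eq_degree, ← nsmul_eq_mul]
      refine Finset.sum_le_card_nsmul _ _ _ fun u hu ↦ le_trans ?_ hr
      rw [integral_ite_const, mul_one]
      simp only [huncol u hu]
      rw [measureReal_forall_eq_false, Finset.prod_map]
      simp only [Function.Embedding.coeFn_mk, h.real_inl]
      calc _ ≤ ∏ x ∈ {x ∈ {x ∈ C.list u | 0 < p x ∧ p x < phat} | C.Survives ω' x},
            exp (-(α * p x)) :=
            Finset.prod_le_prod (fun x _ ↦ by linarith [h.α_mul_p_le x])
              fun x _ ↦ Real.one_sub_le_exp_neg _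
        _ = exp (-(α * C.survivingWeight p phat ω' u)) := by
            rw [← Real.exp_sum, survivingWeight, ← Finset.sum_filter, Finset.mul_sum,
              Finset.sum_neg_distrib]
        _ ≤ _ := exp_le_exp.2 (neg_le_neg (mul_le_mul_of_nonneg_left (hc u hu) h.α_nonneg))
    have h2 := hω.2
    rw [Finset.card_filter] at h2
    push_cast at h2
    simp only [Set.mem_ofPred_eq]
    linarith
  · have : ¬ C.IsColored p phat (glue S ω₁ ω') u ↔ ¬ C.IsColored p phat (glue S ω₂ ω') u := by
      rw [huncol u hu, huncol u hu]
      refine forall₂_congr fun i hi ↦ ?_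
      simp only [Finset.mem_map, Finset.mem_filter, mem_list, Function.Embedding.coeFn_mk] at hi
      obtain ⟨x, hx, rfl⟩ := hi
      rw [hω (.inl x) ⟨x, hx.1.1, rfl⟩]
    simp only [this]
  · intro u _ u' _ huu
    rw [Set.disjoint_left]
    rintro i ⟨x, hx, rfl⟩ ⟨y, hy, hxy⟩
    obtain rfl := Sum.inl_injective hxy
    exact huu (hx.symm.trans hy)
  · split_ifs <;> simp

end IsNibble

end Cover

section Expand

variable {V : Type} [Fintype V] {G : SimpleGraph V} [DecidableRel G.Adj]

/-- The closed neighborhood of a set of vertices. -/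
noncomputable def expand (G : SimpleGraph V) [DecidableRel G.Adj] (S : Finset V) : Finset V :=
  S.biUnion fun v ↦ insert v (G.neighborFinset v)

lemma mem_expand {S : Finset V} {w : V} : w ∈ expand G S ↔ ∃ v ∈ S, w = v ∨ G.Adj v w := by
  simp [expand]

lemma card_expand_le {Δ : ℕ} (hΔ : ∀ v, G.degree v ≤ Δ) (S : Finset V) :
    #(expand G S) ≤ #S * (Δ + 1) :=
  Finset.card_biUnion_le_card_mul _ _ _ fun v _ ↦
    (Finset.card_insert_le _ _).trans (by simpa using hΔ v)

lemma mem_expand_expand_singleton_comm {u w : V} (h : u ∈ expand G (expand G {w})) :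
    w ∈ expand G (expand G {u}) := by
  simp only [mem_expand, Finset.mem_singleton, exists_eq_left] at h ⊢
  obtain ⟨z, hz, hu⟩ := h
  exact ⟨z, hu.imp Eq.symm SimpleGraph.Adj.symm, hz.imp Eq.symm SimpleGraph.Adj.symm⟩

lemma expand_mono {S T : Finset V} (h : S ⊆ T) : expand G S ⊆ expand G T :=
  Finset.biUnion_subset_biUnion_of_subset_left _ h

end Expand

namespace Cover

open MeasureTheory ProbabilityTheory

variable {V W : Type} {G : SimpleGraph V} [Fintype W]
  {C : Cover G W} {p : W → ℝ} {phat α : ℝ} {ν : W ⊕ W → Measure Bool}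

lemma edgeWeight_congr {p q : W → ℝ} {u v : V}
    (h : ∀ x, C.toFun x = u ∨ C.toFun x = v → p x = q x) :
    C.edgeWeight p u v = C.edgeWeight q u v := by
  simp only [edgeWeight_eq_sum]
  refine Finset.sum_congr rfl fun e he ↦ ?_
  rw [mem_edges] at he
  rw [h _ (.inl he.1), h _ (.inr he.2.1)]

namespace IsNibble

variable [∀ i, IsProbabilityMeasure (ν i)]

lemma isReductOn (h : IsNibble p phat α ν) (ω : W ⊕ W → Bool) :
    C.IsReductOn phat Set.univ p {u | ¬ C.IsColored p phat ω u} (C.newWeight p phat ν ω) := by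
  refine ⟨Set.subset_univ _, fun x _ ↦ ⟨h.newWeight_nonneg ω x, h.newWeight_le ω x⟩, ?_⟩
  rintro I ⟨hI1, hI2, hI3⟩ hmod
  have hsurv : ∀ x ∈ I, C.Survives ω x ∧ 0 < p x ∧ p x < phat := by
    intro x hx
    have h0 := h.keep_pos (C := C) x
    obtain ⟨h1, h2⟩ := hmod x hx
    unfold newWeight at h1 h2
    split_ifs at h1 h2 with h3 h4 h5
    · exact ⟨h4, by rwa [div_pos_iff_of_pos_right h0] at h1,
        (le_div_self (h.p_nonneg x) h0 (keep_le_one x)).trans_lt h2⟩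
    all_goals exact absurd h1 (by linarith)
  refine ⟨I ∪ {x | (0 < p x ∧ p x < phat) ∧ ω (.inl x) = true ∧ C.Survives ω x},
    ⟨fun _ _ ↦ trivial, ?_, ?_⟩, Set.subset_union_left, ?_⟩
  · have key : ∀ x y, C.Survives ω x → ω (.inl y) = true → ¬ C.graph.Adj x y := by
      intro x y hx hy hxy
      simp [hx y hxy] at hy
    rintro x (hx | hx) y (hy | hy)
    · exact hI2 hx hy
    · exact key x y (hsurv x hx).1 hy.2.1
    · exact fun hxy ↦ key y x (hsurv y hy).1 hx.2.1 hxy.symm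
    · exact key x y hx.2.2 hy.2.1
  · intro v _
    by_cases hv : C.IsColored p phat ω v
    · obtain ⟨x, hx, hx'⟩ := hv
      exact ⟨x, .inr hx', hx⟩
    · obtain ⟨x, hx, hx'⟩ := hI3 v hv
      exact ⟨x, .inl hx, hx'⟩
  · rintro x (hx | hx)
    exacts [(hsurv x hx).2, hx.1]

lemma exists_good_outcome [Fintype V] [DecidableRel G.Adj] (h : IsNibble p phat α ν)
    (hG : G.CliqueFree 3) {Δ : ℕ} (hΔ : ∀ v, G.degree v ≤ Δ) {n : ℝ}
    (hn : ∀ v, (#(C.list v) : ℝ) ≤ n) {s t₁ t₂ t₃ c r m δ : ℝ}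
    (hs : 0 ≤ s) (ht₁ : 0 ≤ t₁) (ht₂ : 0 ≤ t₂) (ht₃ : 0 ≤ t₃)
    (hr : exp (-(α * c)) ≤ r) (hm0 : 0 < m) (hm : m ≤ phat) (hphat : phat < 1)
    (hp : ∀ x, p x = 0 ∨ m ≤ p x)
    (hc : ∀ v, c + s ≤ ∑ x ∈ C.list v with 0 < p x ∧ p x < phat, C.keep ν x * p x)
    (hδ : exp (-(2 * s ^ 2 / (n * phat ^ 2))) ≤ δ)
    (hδ₁ : exp (-(2 * t₁ ^ 2 / (n * (phat ^ 2) ^ 2))) ≤ δ)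
    (hδ₂ : exp (-(2 * t₂ ^ 2 / (n * (phat * Real.log (1 / m)) ^ 2))) ≤ δ)
    (hδ₃ : exp (-(2 * t₃ ^ 2 / Δ)) ≤ δ)
    (hLLL : 4 * ((Δ + 5) * δ) * (Δ + 1) ^ 4 ≤ 1) :
    ∃ ω : W ⊕ W → Bool, ∀ v,
      |C.vertexWeight (C.newWeight p phat ν ω) v - C.vertexWeight p v| ≤ s ∧
      (∀ u, G.Adj v u →
        C.edgeWeight (C.newWeight p phat ν ω) v u ≤ C.edgeWeight p v u + t₁) ∧
      C.entropy p v - √2 * α * ∑ u ∈ G.neighborFinset v, C.edgeWeight p v u - t₂ ≤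
        C.entropy (C.newWeight p phat ν ω) v ∧
      #{u ∈ G.neighborFinset v | ¬ C.IsColored p phat ω u} ≤ G.degree v * r + t₃ := by
  let B₁ : V → (W ⊕ W → Bool) → Prop := fun v ω ↦
    C.vertexWeight p v + s ≤ C.vertexWeight (C.newWeight p phat ν ω) v
  let B₂ : V → (W ⊕ W → Bool) → Prop := fun v ω ↦
    C.vertexWeight (C.newWeight p phat ν ω) v + s ≤ C.vertexWeight p v
  let B₃ : V → (W ⊕ W → Bool) → Prop := fun v ω ↦ ∃ u ∈ G.neighborFinset v,
    C.edgeWeight p v u + t₁ ≤ C.edgeWeight (C.newWeight p phat ν ω) v u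
  let B₄ : V → (W ⊕ W → Bool) → Prop := fun v ω ↦
    C.entropy (C.newWeight p phat ν ω) v + t₂ ≤
      C.entropy p v - √2 * α * ∑ u ∈ G.neighborFinset v, C.edgeWeight p v u
  let B₅ : V → (W ⊕ W → Bool) → Prop := fun v ω ↦
    C.survivingWeight p phat ω v + s ≤
      ∑ x ∈ C.list v with 0 < p x ∧ p x < phat, C.keep ν x * p x
  let B₆ : V → (W ⊕ W → Bool) → Prop := fun v ω ↦
    (∀ u ∈ G.neighborFinset v, c ≤ C.survivingWeight p phat ω u) ∧
      G.degree v * r + t₃ ≤ #{u ∈ G.neighborFinset v | ¬ C.IsColored p phat ω u}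
  have hδ0 : 0 ≤ δ := (exp_nonneg _).trans hδ
  suffices hgood : ∃ ω, ∀ v,
      ¬ (B₁ v ω ∨ B₂ v ω ∨ B₃ v ω ∨ B₄ v ω ∨ B₅ v ω ∨ B₆ v ω) by
    obtain ⟨ω, hω⟩ := hgood
    refine ⟨ω, fun v ↦ ?_⟩
    have hv := hω v
    simp only [not_or] at hv
    obtain ⟨h1, h2, h3, h4, -, h6⟩ := hv
    refine ⟨?_, ?_, ?_, ?_⟩
    · have h1 := not_le.1 h1
      have h2 := not_le.1 h2
      rw [abs_le]
      constructor <;> linarith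
    · intro u hu
      by_contra hcon
      exact h3 ⟨u, by simpa using hu, (not_le.1 hcon).le⟩
    · have h4 := not_le.1 h4
      linarith
    · by_contra hcon
      refine h6 ⟨fun u _ ↦ ?_, (not_le.1 hcon).le⟩
      have hu := hω u
      simp only [not_or] at hu
      have h5 := not_le.1 hu.2.2.2.2.1
      linarith [hc u]
  refine exists_forall_not_of_dependsOn (ν := ν)
    (S := fun v ↦ C.coords (expand G (expand G {v})))
    (N := fun v ↦ expand G (expand G (expand G (expand G {v}))))
    (d := (Δ + 1) ^ 4) (q := (Δ + 5) * δ) ?_ ?_ ?_ ?_ hLLL ?_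
  · intro v ω ω' hω
    have hsupp : ∀ u ∈ expand G {v}, ∀ x, C.toFun x = u → ∀ i ∈ C.support x, ω i = ω' i := by
      rintro u hu x rfl i hi
      refine hω i ?_
      have := support_subset x hi
      simp only [coords, Set.mem_ofPred_eq, Finset.mem_coe] at this ⊢
      exact mem_expand.2 ⟨_, hu, this⟩
    have hself : v ∈ expand G {v} := mem_expand.2 ⟨v, by simp, .inl rfl⟩
    have hnbr : ∀ u ∈ G.neighborFinset v, u ∈ expand G {v} := fun u hu ↦
      mem_expand.2 ⟨v, by simp, .inr (by simpa using hu)⟩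
    have hnw : ∀ u ∈ expand G {v}, ∀ x, C.toFun x = u →
        C.newWeight p phat ν ω x = C.newWeight p phat ν ω' x := fun u hu x hx ↦
      dependsOn_newWeight x (hsupp u hu x hx)
    have hsurv : ∀ u ∈ expand G {v}, ∀ x, C.toFun x = u →
        (C.Survives ω x ↔ C.Survives ω' x) := fun u hu x hx ↦
      Survives.congr fun y hy ↦ hsupp u hu x hx _ (.inr ⟨y, hy, rfl⟩)
    have hact : ∀ u ∈ expand G {v}, ∀ x, C.toFun x = u → ω (.inl x) = ω' (.inl x) := by
      rintro u hu x rfl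
      refine hω _ ?_
      exact mem_expand.2 ⟨_, hu, .inl rfl⟩
    have hvw : C.vertexWeight (C.newWeight p phat ν ω) v =
        C.vertexWeight (C.newWeight p phat ν ω') v := by
      simp only [vertexWeight_eq_sum]
      exact Finset.sum_congr rfl fun x hx ↦ hnw v hself x (by simpa using hx)
    have hent : C.entropy (C.newWeight p phat ν ω) v =
        C.entropy (C.newWeight p phat ν ω') v := by
      simp only [entropy_eq_sum]
      exact Finset.sum_congr rfl fun x hx ↦ by rw [hnw v hself x (by simpa using hx)]
    have hsw : ∀ u ∈ expand G {v},
        C.survivingWeight p phat ω u = C.survivingWeight p phat ω' u := fun u hu ↦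
      Finset.sum_congr rfl fun x hx ↦ by
        simp only [hsurv u hu x (by simpa using (Finset.mem_filter.1 hx).1)]
    have hedge : ∀ u ∈ G.neighborFinset v, C.edgeWeight (C.newWeight p phat ν ω) v u =
        C.edgeWeight (C.newWeight p phat ν ω') v u := fun u hu ↦
      edgeWeight_congr fun x hx ↦ hx.elim (hnw v hself x) (hnw u (hnbr u hu) x)
    have hcol : ∀ u ∈ G.neighborFinset v,
        (C.IsColored p phat ω u ↔ C.IsColored p phat ω' u) := fun u hu ↦ by
      refine exists_congr fun x ↦ and_congr_right fun hx ↦ ?_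
      rw [hact u (hnbr u hu) x hx, hsurv u (hnbr u hu) x hx]
    have hfilter : ({u ∈ G.neighborFinset v | ¬ C.IsColored p phat ω u} : Finset V) =
        {u ∈ G.neighborFinset v | ¬ C.IsColored p phat ω' u} :=
      Finset.filter_congr fun u hu ↦ by rw [hcol u hu]
    have e₃ : B₃ v ω ↔ B₃ v ω' := exists_congr fun u ↦ and_congr_right fun hu ↦ by
      rw [hedge u hu]
    have e₆ : B₆ v ω ↔ B₆ v ω' := by
      refine and_congr (forall₂_congr fun u hu ↦ ?_) (by rw [hfilter])
      rw [hsw u (hnbr u hu)]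
    simp only [eq_iff_iff]
    refine or_congr ?_ (or_congr ?_ (or_congr e₃ (or_congr ?_ (or_congr ?_ e₆))))
    · simp only [B₁, hvw]
    · simp only [B₂, hvw]
    · simp only [B₄, hent]
    · simp only [B₅, hsw v hself]
  · intro v w hw
    rw [Set.disjoint_left]
    intro i hi hi'
    simp only [coords, Set.mem_ofPred_eq, Finset.mem_coe] at hi hi'
    refine hw (expand_mono (expand_mono ?_) (mem_expand_expand_singleton_comm hi'))
    simpa using hi
  · intro v
    have h1 := card_expand_le hΔ {v}
    have h2 := card_expand_le hΔ (expand G {v})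
    have h3 := card_expand_le hΔ (expand G (expand G {v}))
    have h4 := card_expand_le hΔ (expand G (expand G (expand G {v})))
    have : #(expand G (expand G (expand G (expand G {v})))) ≤ (Δ + 1) ^ 4 :=
      calc _ ≤ _ := h4
        _ ≤ #({v} : Finset V) * (Δ + 1) * (Δ + 1) * (Δ + 1) * (Δ + 1) := by
          gcongr
          refine h3.trans ?_
          gcongr
          exact h2.trans (by gcongr)
        _ = _ := by rw [Finset.card_singleton]; ring
    exact_mod_cast this
  · intro v
    set μ := Measure.pi ν
    have p₁ : μ.real {ω | B₁ v ω} ≤ δ := (h.prob_vertexWeight_ge hG (hn v) hs).trans hδ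
    have p₂ : μ.real {ω | B₂ v ω} ≤ δ := (h.prob_vertexWeight_le hG (hn v) hs).trans hδ
    have p₃ : μ.real {ω | B₃ v ω} ≤ Δ * δ := by
      have : {ω | B₃ v ω} = ⋃ u ∈ G.neighborFinset v,
          {ω | C.edgeWeight p v u + t₁ ≤ C.edgeWeight (C.newWeight p phat ν ω) v u} := by
        ext ω
        simp [B₃]
      rw [this]
      refine (measureReal_biUnion_finset_le _ _).trans ?_
      refine (Finset.sum_le_card_nsmul _ _ δ fun u _ ↦
        (h.prob_edgeWeight_ge hG (hn v) ht₁).trans hδ₁).trans ?_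
      rw [nsmul_eq_mul, G.card_neighborFinset_eq_degree]
      gcongr
      exact hΔ v
    have p₄ : μ.real {ω | B₄ v ω} ≤ δ :=
      (h.prob_entropy_le hG (hn v) ht₂ hm0 hm hphat hp).trans hδ₂
    have p₅ : μ.real {ω | B₅ v ω} ≤ δ := (h.prob_survivingWeight_le hG (hn v) hs).trans hδ
    have p₆ : μ.real {ω | B₆ v ω} ≤ δ :=
      (h.prob_card_uncolored_ge hG (n := Δ) (by exact_mod_cast hΔ v) ht₃ hr).trans hδ₃
    have hor (P Q : (W ⊕ W → Bool) → Prop) :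
        μ.real {ω | P ω ∨ Q ω} ≤ μ.real {ω | P ω} + μ.real {ω | Q ω} :=
      measureReal_union_le _ _
    have := hor (B₁ v) fun ω ↦ B₂ v ω ∨ B₃ v ω ∨ B₄ v ω ∨ B₅ v ω ∨ B₆ v ω
    have := hor (B₂ v) fun ω ↦ B₃ v ω ∨ B₄ v ω ∨ B₅ v ω ∨ B₆ v ω
    have := hor (B₃ v) fun ω ↦ B₄ v ω ∨ B₅ v ω ∨ B₆ v ω
    have := hor (B₄ v) fun ω ↦ B₅ v ω ∨ B₆ v ω
    have := hor (B₅ v) (B₆ v)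
    linarith
  · refine le_trans ?_ hLLL
    exact le_mul_of_one_le_right (by positivity) (one_le_pow₀ (by simp))

end IsNibble

end Cover

section Parameters

lemma eventually_log_bounds : ∃ Δ₀ : ℕ, ∀ Δ : ℕ, Δ₀ ≤ Δ → 10 ^ 4 ≤ Real.log Δ ∧
    Real.log (Real.log Δ) ≤ 1 / 1200 * Real.log Δ ∧ (Δ : ℝ) ^ (-(1 / 10 : ℝ)) ≤ 1 / 10 ^ 5 ∧
    6 * Real.log Δ ≤ 2 * (Δ : ℝ) ^ (1 / 3 : ℝ) := by
  have hcast := tendsto_natCast_atTop_atTop (R := ℝ)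
  have hlog : Filter.Tendsto (fun Δ : ℕ ↦ Real.log Δ) Filter.atTop Filter.atTop :=
    Real.tendsto_log_atTop.comp hcast
  have h1 := hlog.eventually_ge_atTop (10 ^ 4)
  have h2 := hlog.eventually (Real.isLittleO_log_id_atTop.bound
    (show (0 : ℝ) < 1 / 1200 by norm_num))
  have h3 := hcast.eventually ((tendsto_rpow_neg_atTop
    (show (0 : ℝ) < 1 / 10 by norm_num)).eventually_le_const
      (show (0 : ℝ) < 1 / 10 ^ 5 by norm_num))
  have h4 := hcast.eventually ((isLittleO_log_rpow_atTop
    (show (0 : ℝ) < 1 / 3 by norm_num)).bound (show (0 : ℝ) < 1 / 3 by norm_num))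
  obtain ⟨Δ₀, h⟩ := Filter.eventually_atTop.1 (h1.and (h2.and (h3.and h4)))
  refine ⟨Δ₀, fun Δ hΔ ↦ ?_⟩
  obtain ⟨h1, h2, h3, h4⟩ := h Δ hΔ
  simp only [id, Real.norm_eq_abs] at h2 h4
  rw [abs_of_nonneg (by linarith : 0 ≤ Real.log Δ)] at h2 h4
  rw [abs_of_nonneg (by positivity)] at h4
  exact ⟨h1, (le_abs_self _).trans h2, h3, by linarith⟩

variable {D K : ℝ}

lemma log_ceil_bounds (hD : 1 < D) (hlog : 10 ^ 4 ≤ Real.log D)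
    (hloglog : Real.log (Real.log D) ≤ 1 / 1200 * Real.log D)
    (hK : K = ⌈120 * D / Real.log D⌉₊) :
    120 * D ≤ K * Real.log D ∧ K * Real.log D ≤ 240 * D ∧
      (11 / 12 + 99 / 1200) * Real.log D ≤ Real.log K := by
  have hl : 0 < Real.log D := by linarith
  have h1 : 120 * D / Real.log D ≤ K := hK ▸ Nat.le_ceil _
  have h2 : K < 120 * D / Real.log D + 1 := hK ▸ Nat.ceil_lt_add_one (by positivity)
  have h3 : Real.log D ≤ D := (Real.log_le_sub_one_of_pos (by linarith)).trans (by linarith)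
  refine ⟨(div_le_iff₀ hl).1 h1, ?_, ?_⟩
  · have := mul_le_mul_of_nonneg_right h2.le hl.le
    rw [add_mul, div_mul_cancel₀ _ hl.ne'] at this
    linarith
  · have h4 := Real.log_le_log (by positivity) h1
    rw [Real.log_div (by positivity) hl.ne', Real.log_mul (by norm_num) (by positivity)] at h4
    have h5 : 0 ≤ Real.log 120 := Real.log_nonneg (by norm_num)
    linarith

lemma six_mul_log_le_sq (hD : 1 < D) (h3 : 6 * Real.log D ≤ 2 * D ^ (1 / 3 : ℝ)) (hK0 : 0 < K)
    (hKD : K ≤ D) {q : ℝ} (hq0 : 0 < q) (hq : q ≤ D ^ (-(11 / 12 : ℝ))) :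
    6 * Real.log D ≤ 2 * (D ^ (-(1 / 6 : ℝ))) ^ 2 / (K * q ^ 2) := by
  have hD0 : 0 < D := by linarith
  have h1 : K * q ^ 2 ≤ D * (D ^ (-(11 / 12 : ℝ))) ^ 2 := by gcongr
  refine (h3.trans ?_).trans (div_le_div_of_nonneg_left (by positivity) (by positivity) h1)
  rw [mul_div_assoc]
  gcongr
  rw [← Real.rpow_mul_natCast hD0.le, ← Real.rpow_mul_natCast hD0.le, ← Real.rpow_one_add' hD0.le
    (by norm_num), ← Real.rpow_sub hD0]
  exact Real.rpow_le_rpow_of_exponent_le hD.le (by norm_num)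

lemma six_mul_log_le_cube (hD : 1 < D) (hlog : 10 ^ 4 ≤ Real.log D) (hK0 : 0 < K)
    (hK : K * Real.log D ≤ 240 * D) :
    6 * Real.log D ≤ 2 * (D ^ (-(1 / 3 : ℝ)) / K) ^ 2 / (K * ((D ^ (-(11 / 12 : ℝ))) ^ 2) ^ 2) := by
  have hD0 : 0 < D := by linarith
  have h1 : 2 * (D ^ (-(1 / 3 : ℝ)) / K) ^ 2 / (K * ((D ^ (-(11 / 12 : ℝ))) ^ 2) ^ 2) =
      2 * (D / K) ^ 3 := by
    have e : (D ^ (-(1 / 3 : ℝ))) ^ 2 = D ^ 3 * ((D ^ (-(11 / 12 : ℝ))) ^ 2) ^ 2 := by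
      rw [← pow_mul, ← Real.rpow_mul_natCast hD0.le, ← Real.rpow_mul_natCast hD0.le,
        ← Real.rpow_natCast, ← Real.rpow_add hD0]
      norm_num
    have : 0 < D ^ (-(11 / 12 : ℝ)) := by positivity
    rw [div_pow, e]
    field_simp
  have h2 : Real.log D / 240 ≤ D / K := by
    rw [div_le_div_iff₀ (by norm_num) hK0]
    linarith
  rw [h1]
  have h3 : (Real.log D / 240) ^ 3 ≤ (D / K) ^ 3 := by gcongr
  nlinarith [mul_nonneg (sub_nonneg.2 hlog) (sub_nonneg.2 hlog)]

lemma exp_neg_le_of_le_log (hD : 1 < D) {a : ℝ} (h : 6 * Real.log D ≤ a) :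
    exp (-a) ≤ (D ^ 6)⁻¹ := by
  rw [← Real.exp_log (show 0 < D by linarith), ← Real.exp_nat_mul, ← Real.exp_neg,
    Real.exp_le_exp]
  push_cast
  linarith

lemma lovasz_local_condition (hD : 400 ≤ D) : 4 * ((D + 5) * (D ^ 6)⁻¹) * (D + 1) ^ 4 ≤ 1 := by
  have hD0 : 0 < D := by linarith
  have h1 : 4 * ((D + 5) * (D ^ 6)⁻¹) * (D + 1) ^ 4 ≤
      4 * ((2 * D) * (D ^ 6)⁻¹) * (2 * D) ^ 4 := by gcongr <;> linarith
  refine h1.trans ?_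
  have : 4 * ((2 * D) * (D ^ 6)⁻¹) * (2 * D) ^ 4 = 128 / D := by field_simp; norm_num
  rw [this, div_le_one hD0]
  linarith

lemma exp_neg_le_one_sub {l : ℝ} (hl : 10 ^ 4 ≤ l) :
    exp (-(1 / l * (68 / 100))) ≤ 1 - 2 / (3 * l) := by
  have hl0 : 0 < l := by linarith
  have h1 := Real.add_one_le_exp (1 / l * (68 / 100))
  rw [Real.exp_neg]
  refine (inv_anti₀ (by positivity) h1).trans ?_
  rw [inv_le_iff_one_le_mul₀ (by positivity)]
  have : (1 - 2 / (3 * l)) * (1 / l * (68 / 100) + 1) =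
      1 + (4 * l - 136) / (300 * l ^ 2) := by field_simp; ring
  rw [this, le_add_iff_nonneg_right]
  exact div_nonneg (by linarith) (by positivity)

lemma moderate_weight_ge {l logK η s w B S Q : ℝ} (hl : 10 ^ 4 ≤ l) (hη : η ≤ 1 / 10 ^ 5)
    (hs : s ≤ η) (hw : |w - 1| ≤ η) (hlogK : (11 / 12 + 99 / 1200) * l ≤ logK) (hlogK' : logK ≤ l)
    (hQ : logK - l / 40 ≤ Q) (hQ' : Q ≤ (w - B) * logK + B * (11 / 12 * l))
    (hB : 0 ≤ B) (hS : S ≤ √2 / 120) :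
    68 / 100 + s ≤ w - B - S := by
  have h2 : √2 ≤ 1.42 := (Real.sqrt_le_left (by norm_num)).2 (by norm_num)
  rw [abs_le] at hw
  have h3 : B * (99 / 1200 * l) ≤ (1 / 40 + η) * l := by nlinarith
  have h4 : B * (99 / 1200) ≤ 1 / 40 + η := by
    refine le_of_mul_le_mul_right ?_ (show 0 < l by linarith)
    linarith
  linarith

end Parameters

namespace Cover

open MeasureTheory ProbabilityTheory

/-- The Bernoulli measure on `Bool` with success probability `q`. -/
noncomputable def bernoulli (q : ℝ) : Measure Bool :=
  ENNReal.ofReal q • Measure.dirac true + ENNReal.ofReal (1 - q) • Measure.dirac false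

lemma isProbabilityMeasure_bernoulli {q : ℝ} (h0 : 0 ≤ q) (h1 : q ≤ 1) :
    IsProbabilityMeasure (bernoulli q) := by
  constructor
  rw [bernoulli]
  simp [← ENNReal.ofReal_add h0 (sub_nonneg.2 h1)]

lemma bernoulli_real_false {q : ℝ} (h1 : q ≤ 1) : (bernoulli q).real {false} = 1 - q := by
  simp [bernoulli, Measure.real, h1]

lemma exists_isNibble {W : Type} {p : W → ℝ} {phat α : ℝ}
    (h0 : ∀ x, 0 ≤ p x) (hle : ∀ x, p x ≤ phat) (hphat : 0 < phat)
    (hα : 0 ≤ α) (hα' : α * phat ≤ 1 / 4) :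
    ∃ ν : W ⊕ W → Measure Bool, (∀ i, IsProbabilityMeasure (ν i)) ∧ IsNibble p phat α ν := by
  have h1 (x : W) : α * p x ≤ 1 :=
    (mul_le_mul_of_nonneg_left (hle x) hα).trans (by linarith)
  have h2 (x : W) : p x / phat ≤ 1 := (div_le_one hphat).2 (hle x)
  refine ⟨Sum.elim (fun x ↦ bernoulli (α * p x)) fun x ↦ bernoulli (p x / phat), ?_,
    h0, hle, hphat, hα, hα', fun x ↦ bernoulli_real_false (h1 x),
    fun x ↦ bernoulli_real_false (h2 x)⟩
  rintro (x | x)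
  exacts [isProbabilityMeasure_bernoulli (mul_nonneg hα (h0 x)) (h1 x),
    isProbabilityMeasure_bernoulli (div_nonneg (h0 x) hphat.le) (h2 x)]

variable {V W : Type} {G : SimpleGraph V} [Fintype W]
  {C : Cover G W} {p : W → ℝ} {phat α : ℝ} {ν : W ⊕ W → Measure Bool}

lemma IsNibble.vertexWeight_sub_le_sum_keep [Fintype V] [DecidableRel G.Adj]
    [∀ i, IsProbabilityMeasure (ν i)] (h : IsNibble p phat α ν) (v : V) :
    C.vertexWeight p v - ∑ x ∈ C.list v with p x = phat, p x -
        α * ∑ u ∈ G.neighborFinset v, C.edgeWeight p v u ≤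
      ∑ x ∈ C.list v with 0 < p x ∧ p x < phat, C.keep ν x * p x := by
  rw [← sum_mul_sum_adj, vertexWeight_eq_sum, Finset.sum_filter, Finset.sum_filter,
    Finset.mul_sum, ← Finset.sum_sub_distrib, ← Finset.sum_sub_distrib]
  refine Finset.sum_le_sum fun x _ ↦ ?_
  have h0 := h.p_nonneg x
  have h1 : 0 ≤ α * (p x * ∑ y with C.graph.Adj x y, p y) :=
    mul_nonneg h.α_nonneg (mul_nonneg h0 (Finset.sum_nonneg fun y _ ↦ h.p_nonneg y))
  have h2 := mul_le_mul_of_nonneg_left (h.one_sub_le_keep (C := C) x) h0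
  split_ifs with hx hx' hx'
  · exact absurd hx hx'.2.ne
  · linarith
  · linarith
  · have : p x = 0 := by
      by_contra hne
      exact hx' ⟨lt_of_le_of_ne h0 (Ne.symm hne), lt_of_le_of_ne (h.p_le x) hx⟩
    simp [this]

lemma entropy_le_add_mul_log {K : ℝ} (hK : 0 < K) (h0 : ∀ x, 0 ≤ p x)
    (hp : ∀ x, p x = 0 ∨ 1 / K ≤ p x) (v : V) :
    C.entropy p v ≤ (C.vertexWeight p v - ∑ x ∈ C.list v with p x = phat, p x) * Real.log K +
      (∑ x ∈ C.list v with p x = phat, p x) * Real.log (1 / phat) := by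
  rw [entropy_eq_sum, vertexWeight_eq_sum, Finset.sum_filter, ← Finset.sum_sub_distrib,
    Finset.sum_mul, Finset.sum_mul, ← Finset.sum_add_distrib]
  refine Finset.sum_le_sum fun x _ ↦ ?_
  split_ifs with hx
  · simp [hx]
  · rcases hp x with h | h
    · simp [h]
    · have h1 : 0 < p x := lt_of_lt_of_le (by positivity) h
      rw [sub_zero, zero_mul, add_zero]
      refine mul_le_mul_of_nonneg_left (Real.log_le_log (by positivity) ?_) (h0 x)
      rwa [one_div_le h1 hK]

end Cover

/-- **Lemma 6 (good reducts).** -/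
theorem exists_good_reduct :
    ∃ Δ₀ : ℕ, ∀ Δ : ℕ, Δ₀ ≤ Δ →
      ∀ (V W : Type) [Fintype V] [Fintype W] (G : SimpleGraph V) [DecidableRel G.Adj]
        (C : Cover G W) (p : W → ℝ),
        G.CliqueFree 3 → G.maxDegree ≤ Δ →
        -- `|L(v)| = k := ⌈120Δ/ln Δ⌉` for every vertex `v`
        (∀ v : V, Fintype.card {x : W // C.toFun x = v} = ⌈(120 * Δ : ℝ) / Real.log Δ⌉₊) →
        -- `p : V(H) → [0, p̂]` with `p̂ := Δ^{-11/12}`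
        (∀ x : W, 0 ≤ p x ∧ p x ≤ (Δ : ℝ) ^ (-(11 / 12 : ℝ))) →
        -- hypothesis (1): `|p(v) − 1| ≤ Δ^{-1/10}`
        (∀ v : V, |C.vertexWeight p v - 1| ≤ (Δ : ℝ) ^ (-(1 / 10 : ℝ))) →
        -- hypothesis (2): `p(uv) ≤ √2·k⁻¹`
        (∀ u v : V, G.Adj u v →
          C.edgeWeight p u v ≤ Real.sqrt 2 / (⌈(120 * Δ : ℝ) / Real.log Δ⌉₊ : ℝ)) →
        -- hypothesis (3): `Q(v) ≥ ln k − (ln Δ)/40`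
        (∀ v : V, Real.log (⌈(120 * Δ : ℝ) / Real.log Δ⌉₊ : ℝ) - Real.log Δ / 40
            ≤ C.entropy p v) →
        -- hypothesis (4): `p(x) = 0` or `p(x) ≥ 1/k`
        (∀ x : W, p x = 0 ∨ 1 / (⌈(120 * Δ : ℝ) / Real.log Δ⌉₊ : ℝ) ≤ p x) →
        -- conclusion: there is a reduct `(G', L', H', p')`, given by the vertex set `A`
        -- of `G'` and the new weight function `p'`, such that:
        ∃ (A : Set V) (p' : W → ℝ),
          C.IsReductOn ((Δ : ℝ) ^ (-(11 / 12 : ℝ))) Set.univ p A p' ∧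
          -- (1): `|p'(v) − p(v)| ≤ Δ^{-1/6}`
          (∀ v ∈ A, |C.vertexWeight p' v - C.vertexWeight p v| ≤ (Δ : ℝ) ^ (-(1 / 6 : ℝ))) ∧
          -- (2): `p'(uv) ≤ p(uv) + k⁻¹Δ^{-1/3}`
          (∀ u v : V, u ∈ A → v ∈ A → G.Adj u v →
            C.edgeWeight p' u v ≤ C.edgeWeight p u v +
              (Δ : ℝ) ^ (-(1 / 3 : ℝ)) / (⌈(120 * Δ : ℝ) / Real.log Δ⌉₊ : ℝ)) ∧
          -- (3): `Q'(v) ≥ Q(v) − 2·deg_G(v)/(k·ln Δ) − ln Δ·Δ^{-1/6}`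
          (∀ v ∈ A, C.entropy p v -
              2 * (G.degree v : ℝ) / ((⌈(120 * Δ : ℝ) / Real.log Δ⌉₊ : ℝ) * Real.log Δ) -
              Real.log Δ * (Δ : ℝ) ^ (-(1 / 6 : ℝ)) ≤ C.entropy p' v) ∧
          -- (4): `deg_{G'}(v) ≤ deg_G(v)·(1 − 2/(3 ln Δ)) + Δ^{2/3}`
          (∀ v ∈ A, ({u : V | u ∈ A ∧ G.Adj v u}.ncard : ℝ) ≤
              (G.degree v : ℝ) * (1 - 2 / (3 * Real.log Δ)) + (Δ : ℝ) ^ ((2 : ℝ) / 3)) ∧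
          -- (5): `p'(x) = 0` or `p'(x) ≥ 1/k` for colors over `A`
          (∀ x : W, C.toFun x ∈ A →
            p' x = 0 ∨ 1 / (⌈(120 * Δ : ℝ) / Real.log Δ⌉₊ : ℝ) ≤ p' x) := by
  obtain ⟨Δ₀, hΔ₀⟩ := eventually_log_bounds
  refine ⟨Δ₀, fun Δ hΔ V W _ _ G _ C p hG hmax hcard hp hweight hedge hent hp0 ↦ ?_⟩
  obtain ⟨hlog, hloglog, hη, hcube⟩ := hΔ₀ Δ hΔ
  set D : ℝ := (Δ : ℝ) with hDdef
  set K : ℝ := (⌈120 * D / Real.log D⌉₊ : ℝ) with hKdef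
  set l := Real.log D with hldef
  have hl0 : 0 < l := by linarith
  have hD0 : 0 < D := by
    rcases Nat.eq_zero_or_pos Δ with h0 | h0
    · simp [hldef, hDdef, h0] at hl0
    · exact hDdef ▸ Nat.cast_pos.2 h0
  have hD : 10 ^ 4 < D := by linarith [Real.log_le_sub_one_of_pos hD0]
  have hD1 : 1 < D := by linarith
  obtain ⟨hK1, hK2, hK3⟩ := log_ceil_bounds hD1 hlog hloglog hKdef
  rw [← hldef] at hK1 hK2 hK3
  have hK0 : 0 < K := pos_of_mul_pos_left (lt_of_lt_of_le (by positivity) hK1) hl0.le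
  have hKD : K ≤ D := by nlinarith
  have hlogK : Real.log K ≤ l := Real.log_le_log hK0 hKD
  set phat := D ^ (-(11 / 12 : ℝ)) with hphatdef
  have hphat0 : 0 < phat := by positivity
  have hlogphat : Real.log (1 / phat) = 11 / 12 * l := by
    rw [one_div, Real.log_inv, Real.log_rpow hD0]
    ring
  have hKphat : 1 / K ≤ phat := by
    rw [one_div_le hK0 hphat0, ← Real.log_le_log_iff (by positivity) hK0, hlogphat]
    linarith
  have hphat1 : phat ≤ 1 / 10 ^ 5 :=
    (Real.rpow_le_rpow_of_exponent_le hD1.le (by norm_num)).trans hη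
  have hs : D ^ (-(1 / 6 : ℝ)) ≤ D ^ (-(1 / 10 : ℝ)) :=
    Real.rpow_le_rpow_of_exponent_le hD1.le (by norm_num)
  have hinv : 1 / l ≤ 1 := (div_le_one hl0).2 (by linarith)
  obtain ⟨ν, hν, h⟩ := Cover.exists_isNibble (fun x ↦ (hp x).1) (fun x ↦ (hp x).2) hphat0
    (α := 1 / l) (by positivity) (by nlinarith)
  have hdeg (v : V) : G.degree v ≤ Δ := (G.degree_le_maxDegree v).trans hmax
  have hsum (v : V) : ∑ u ∈ G.neighborFinset v, C.edgeWeight p v u ≤ G.degree v * (√2 / K) := by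
    rw [← G.card_neighborFinset_eq_degree, ← nsmul_eq_mul]
    exact Finset.sum_le_card_nsmul _ _ _ fun u hu ↦ hedge v u (by simpa using hu)
  have hc (v : V) : 68 / 100 + D ^ (-(1 / 6 : ℝ)) ≤
      ∑ x ∈ C.list v with 0 < p x ∧ p x < phat, C.keep ν x * p x := by
    refine le_trans ?_ (h.vertexWeight_sub_le_sum_keep v)
    refine moderate_weight_ge hlog hη hs (hweight v) hK3 hlogK (hent v)
      (hlogphat ▸ Cover.entropy_le_add_mul_log hK0 (fun x ↦ (hp x).1) hp0 v)
      (Finset.sum_nonneg fun x _ ↦ (hp x).1) ?_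
    have h1 : (G.degree v : ℝ) ≤ D := hDdef ▸ Nat.cast_le.2 (hdeg v)
    calc 1 / l * ∑ u ∈ G.neighborFinset v, C.edgeWeight p v u
        ≤ 1 / l * (D * (√2 / K)) := by
          gcongr
          exact (hsum v).trans (by gcongr)
      _ = √2 * (D / (K * l)) := by field_simp
      _ ≤ √2 * (1 / 120) := by
          refine mul_le_mul_of_nonneg_left ?_ (Real.sqrt_nonneg 2)
          rw [div_le_div_iff₀ (by positivity) (by norm_num)]
          linarith
      _ = √2 / 120 := by ring
  have hlist (v : V) : (#(C.list v) : ℝ) ≤ K := by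
    have := hcard v
    rw [Fintype.card_subtype] at this
    rw [hKdef, ← this, Cover.list]
  have hδ₂ : 6 * l ≤ 2 * (l * D ^ (-(1 / 6 : ℝ))) ^ 2 /
      (K * (phat * Real.log (1 / (1 / K))) ^ 2) := by
    have hlogK0 : 0 < Real.log K := by nlinarith
    have h1 := six_mul_log_le_sq hD1 hcube hK0 hKD (q := phat * Real.log K / l)
      (by positivity) (by rw [div_le_iff₀ hl0]; gcongr)
    convert h1 using 1
    rw [one_div_one_div]
    field_simp
  have hδ₃ : 6 * l ≤ 2 * (D ^ ((2 : ℝ) / 3)) ^ 2 / D := by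
    refine hcube.trans (le_of_eq ?_)
    rw [mul_div_assoc, ← Real.rpow_mul_natCast hD0.le, ← Real.rpow_sub_one hD0.ne']
    norm_num
  obtain ⟨ω, hω⟩ := h.exists_good_outcome hG hdeg hlist (s := D ^ (-(1 / 6 : ℝ)))
    (t₁ := D ^ (-(1 / 3 : ℝ)) / K) (t₂ := l * D ^ (-(1 / 6 : ℝ))) (t₃ := D ^ ((2 : ℝ) / 3))
    (by positivity) (by positivity) (by positivity) (by positivity) (exp_neg_le_one_sub hlog)
    (m := 1 / K) (by positivity) hKphat (by linarith) hp0 hc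
    (exp_neg_le_of_le_log hD1 (six_mul_log_le_sq hD1 hcube hK0 hKD hphat0 le_rfl))
    (exp_neg_le_of_le_log hD1 (six_mul_log_le_cube hD1 hlog hK0 hK2))
    (exp_neg_le_of_le_log hD1 hδ₂) (exp_neg_le_of_le_log hD1 hδ₃)
    (lovasz_local_condition (by linarith))
  refine ⟨{u | ¬ C.IsColored p phat ω u}, C.newWeight p phat ν ω, h.isReductOn ω,
    fun v _ ↦ (hω v).1, fun u v _ _ huv ↦ (hω u).2.1 v huv, fun v _ ↦ ?_, fun v _ ↦ ?_,
    fun x _ ↦ h.newWeight_eq_zero_or hKphat hp0 ω x⟩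
  · refine le_trans ?_ (hω v).2.2.1
    have h1 : √2 * (1 / l) * ∑ u ∈ G.neighborFinset v, C.edgeWeight p v u ≤
        √2 * (1 / l) * (G.degree v * (√2 / K)) := by
      gcongr
      exact hsum v
    have h2 : √2 * (1 / l) * (G.degree v * (√2 / K)) = 2 * G.degree v / (K * l) := by
      rw [← Real.mul_self_sqrt (show (0 : ℝ) ≤ 2 by norm_num)]
      simp only [Real.sqrt_mul_self (Real.sqrt_nonneg 2)]
      field_simp
    linarith
  · convert (hω v).2.2.2 using 2
    rw [← Set.ncard_coe_finset]
    congr 1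
    ext u
    simp [and_comm]
end

section
/- (Alon) For every ε > 0 there exists d₀ such that every finite simple graph G with average degree d := 2|E(G)|/|V(G)| ≥ d₀ satisfies χ_ℓ(G) ≥ (1/2 − ε)·log₂ d, where χ_ℓ denotes the list chromatic number. -/
open Finset Real

/-- `G` is `k`-choosable: for every assignment of lists of size at least `k` to the
vertices, `G` has a proper coloring from the lists. -/
def Choosable {V : Type} (G : SimpleGraph V) (k : ℕ) : Prop :=
  ∀ (α : Type) (L : V → Finset α), (∀ v, k ≤ (L v).card) →
    ∃ c : V → α, (∀ v, c v ∈ L v) ∧ ∀ ⦃u v : V⦄, G.Adj u v → c u ≠ c v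

/-- The list chromatic number `χ_ℓ(G)`. -/
noncomputable def listChromaticNumber {V : Type} (G : SimpleGraph V) : ℕ :=
  sInf {k : ℕ | Choosable G k}

open scoped Classical in
/-- A bound for the number of functions on `V` that lie in sets of density at most `x` at every
point of `Z`. -/
lemma card_filter_forall_mem_le {V Ω : Type*} [Fintype V] [Fintype Ω] (Z : Finset V)
    (R : V → Finset Ω) (x : ℝ) (hR : ∀ v ∈ Z, (#(R v) : ℝ) ≤ x * Fintype.card Ω)
    (p : (V → Ω) → Prop) [DecidablePred p] (hp : ∀ f, p f → ∀ v ∈ Z, f v ∈ R v) :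
    (#{f : V → Ω | p f} : ℝ) ≤ x ^ #Z * (Fintype.card Ω : ℝ) ^ Fintype.card V := by
  have hsub : ({f : V → Ω | p f} : Finset (V → Ω))
      ⊆ Fintype.piFinset (fun v => if v ∈ Z then R v else univ) := by
    intro f hf
    refine Fintype.mem_piFinset.2 fun v => ?_
    by_cases hv : v ∈ Z
    · simpa [hv] using hp f (mem_filter.1 hf).2 v hv
    · simp [hv]
  refine (Nat.cast_le.2 (card_le_card hsub)).trans ?_
  rw [Fintype.card_piFinset]
  push_cast
  calc ∏ v : V, (#(if v ∈ Z then R v else univ) : ℝ)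
      ≤ ∏ v : V, ((if v ∈ Z then x else 1) * Fintype.card Ω) := by
        refine prod_le_prod (fun _ _ => by positivity) fun v _ => ?_
        by_cases hv : v ∈ Z
        · simpa [hv] using hR v hv
        · simp [hv]
    _ = x ^ #Z * (Fintype.card Ω : ℝ) ^ Fintype.card V := by
        rw [prod_mul_distrib, prod_ite_mem, univ_inter, prod_const, prod_const, card_univ]

/-- For `M = 2 s ^ 2`, at least a `2 ^ (-s - 1)` proportion of the `s`-subsets of a
`2 * M`-set lies in any given half. -/
lemma choose_two_mul_le (s : ℕ) :
    ((2 * (2 * s ^ 2)).choose s : ℝ) ≤ 2 ^ (s + 1) * ((2 * s ^ 2).choose s : ℝ) := by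
  rcases Nat.eq_zero_or_pos s with rfl | hs
  · norm_num
  have hs' : (1 : ℝ) ≤ s := by exact_mod_cast hs
  set M := 2 * s ^ 2 with hM
  have hsM : s ≤ M := by nlinarith
  have hMr : (M : ℝ) = 2 * s ^ 2 := by simp [hM]
  have hMpos : (0 : ℝ) < M := by rw [hMr]; positivity
  have h1 : ((2 * M).descFactorial s : ℝ) ≤ (2 * M : ℝ) ^ s := by
    exact_mod_cast Nat.descFactorial_le_pow (2 * M) s
  have h2 : ((M - s : ℝ)) ^ s ≤ (M.descFactorial s : ℝ) := by
    have h := Nat.pow_sub_le_descFactorial M s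
    have h' : (M - s) ^ s ≤ M.descFactorial s :=
      (Nat.pow_le_pow_left (by omega) s).trans h
    have : (((M - s : ℕ) : ℝ)) ^ s ≤ (M.descFactorial s : ℝ) := by exact_mod_cast h'
    rwa [Nat.cast_sub hsM] at this
  have h3 : (1 / 2 : ℝ) ≤ (1 + -(s / M : ℝ)) ^ s := by
    have hle : (s / M : ℝ) ≤ 1 := by
      rw [div_le_one hMpos]; exact_mod_cast hsM
    refine le_trans (le_of_eq ?_) (one_add_mul_le_pow (by linarith) s)
    rw [hMr]; field_simp; ring
  have h4 : (M : ℝ) ^ s ≤ 2 * (M - s : ℝ) ^ s := by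
    have : (M - s : ℝ) = M * (1 + -(s / M : ℝ)) := by field_simp; ring
    rw [this, mul_pow]
    nlinarith [pow_pos hMpos s]
  have h5 : ((2 * M).descFactorial s : ℝ) ≤ 2 ^ (s + 1) * (M.descFactorial s : ℝ) := by
    calc _ ≤ (2 * M : ℝ) ^ s := h1
      _ = 2 ^ s * (M : ℝ) ^ s := mul_pow _ _ _
      _ ≤ 2 ^ s * (2 * (M.descFactorial s : ℝ)) := by gcongr; linarith
      _ = _ := by ring
  rw [Nat.descFactorial_eq_factorial_mul_choose, Nat.descFactorial_eq_factorial_mul_choose] at h5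
  push_cast at h5
  have hf : (0 : ℝ) < (s.factorial : ℝ) := by exact_mod_cast s.factorial_pos
  refine le_of_mul_le_mul_left ?_ hf
  linarith

open scoped Classical in
/-- A random choice of a sparse set `B` of vertices (those with first coordinate `0`) and lists
on it: few vertices lie in `B`, or miss, for some half `T` of the colors, a neighbor in `B` with
its list inside `T`. -/
lemma exists_sparse_lists {V Λ : Type*} [Fintype V] [Fintype Λ] [Nonempty Λ]
    (G : SimpleGraph V) {ι : Type*} (𝒯 : Finset ι) (S : ι → Finset Λ) (N : ℕ) [NeZero N]
    (q D : ℝ) (hq0 : 0 ≤ q) (hq1 : q ≤ 1)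
    (hS : ∀ T ∈ 𝒯, q * Fintype.card Λ ≤ #(S T))
    (hdeg : ∀ v, D ≤ (#{w | G.Adj v w} : ℝ))
    (hD : #𝒯 * Real.exp (-(q / N * D)) ≤ 1 / N) :
    ∃ (f : V → Fin N × Λ) (X : Finset V),
      (∀ v ∉ X, ∀ T ∈ 𝒯, ∃ w, G.Adj v w ∧ (f w).1 = 0 ∧ (f w).2 ∈ S T) ∧
      (#{v | (f v).1 = 0} + #X : ℝ) ≤ 2 * Fintype.card V / N := by
  have hN : (0 : ℝ) < N := by exact_mod_cast Nat.pos_of_ne_zero (NeZero.ne N)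
  have hN1 : (1 : ℝ) ≤ N := by exact_mod_cast Nat.pos_of_ne_zero (NeZero.ne N)
  have hΩ : (Fintype.card (Fin N × Λ) : ℝ) = N * Fintype.card Λ := by simp
  set C : ℝ := (Fintype.card (Fin N × Λ) : ℝ) ^ Fintype.card V with hC
  have hB : ∀ v : V, (#{f : V → Fin N × Λ | (f v).1 = 0} : ℝ) ≤ 1 / N * C := by
    intro v
    have h := card_filter_forall_mem_le ({v} : Finset V)
      (fun _ => ({0} : Finset (Fin N)) ×ˢ (univ : Finset Λ)) (1 / N : ℝ) (by
        intro _ _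
        rw [card_product, hΩ]
        simp only [card_singleton, card_univ, one_mul]
        exact le_of_eq (by field_simp))
      (fun f => (f v).1 = 0) (fun f hf _ hw => by
        obtain rfl := mem_singleton.1 hw
        exact mem_product.2 ⟨mem_singleton.2 hf, mem_univ _⟩)
    simpa only [card_singleton, pow_one] using h
  have hbadT : ∀ v : V, ∀ T ∈ 𝒯,
      (#{f : V → Fin N × Λ | ∀ w, G.Adj v w → ¬ ((f w).1 = 0 ∧ (f w).2 ∈ S T)} : ℝ)
        ≤ Real.exp (-(q / N * D)) * C := by
    intro v T hT
    have h := card_filter_forall_mem_le ({w | G.Adj v w} : Finset V)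
      (fun _ => (({0} : Finset (Fin N)) ×ˢ S T)ᶜ) (1 - q / N : ℝ) (by
        intro _ _
        rw [card_compl, Nat.cast_sub (card_le_univ _), card_product, hΩ]
        simp only [card_singleton, one_mul]
        have := hS T hT
        have h2 : (1 - q / N) * (N * (Fintype.card Λ : ℝ))
          = N * (Fintype.card Λ : ℝ) - q * Fintype.card Λ := by field_simp
        rw [h2]; linarith)
      (fun f => ∀ w, G.Adj v w → ¬ ((f w).1 = 0 ∧ (f w).2 ∈ S T))
      (fun f hf w hw => by
        rw [mem_compl, mem_product, mem_singleton]
        exact hf w (mem_filter.1 hw).2)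
    refine h.trans ?_
    gcongr
    have hx : 0 ≤ 1 - q / N := by
      have : q / N ≤ 1 := by rw [div_le_one hN]; linarith
      linarith
    calc (1 - q / N) ^ #{w | G.Adj v w}
        ≤ Real.exp (-(q / N)) ^ #{w | G.Adj v w} := by
          gcongr
          exact Real.one_sub_le_exp_neg _
      _ = Real.exp (-(q / N * #{w | G.Adj v w})) := by
          rw [← Real.exp_nat_mul]; congr 1; ring
      _ ≤ _ := by
          have := hdeg v
          gcongr
  have hbad : ∀ v : V, (#{f : V → Fin N × Λ |
      ∃ T ∈ 𝒯, ∀ w, G.Adj v w → ¬ ((f w).1 = 0 ∧ (f w).2 ∈ S T)} : ℝ) ≤ 1 / N * C := by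
    intro v
    have hsub : ({f : V → Fin N × Λ |
        ∃ T ∈ 𝒯, ∀ w, G.Adj v w → ¬ ((f w).1 = 0 ∧ (f w).2 ∈ S T)} : Finset _)
        ⊆ 𝒯.biUnion fun T => {f : V → Fin N × Λ |
          ∀ w, G.Adj v w → ¬ ((f w).1 = 0 ∧ (f w).2 ∈ S T)} := by
      intro f hf
      simpa using hf
    calc _ ≤ (∑ T ∈ 𝒯, (#{f : V → Fin N × Λ |
          ∀ w, G.Adj v w → ¬ ((f w).1 = 0 ∧ (f w).2 ∈ S T)} : ℝ)) := by
          exact_mod_cast (card_le_card hsub).trans card_biUnion_le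
      _ ≤ ∑ T ∈ 𝒯, Real.exp (-(q / N * D)) * C := sum_le_sum (hbadT v)
      _ = #𝒯 * Real.exp (-(q / N * D)) * C := by rw [sum_const, nsmul_eq_mul]; ring
      _ ≤ 1 / N * C := by gcongr
  have key : ∀ (P : (V → Fin N × Λ) → V → Prop) [∀ f v, Decidable (P f v)],
      (∀ v, (#{f | P f v} : ℝ) ≤ 1 / N * C) →
      ∑ f, (#{v | P f v} : ℝ) ≤ Fintype.card V * (1 / N * C) := by
    intro P _ hP
    calc ∑ f, (#{v | P f v} : ℝ) = ∑ v, (#{f | P f v} : ℝ) := by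
          simp only [card_filter, Nat.cast_sum]
          exact sum_comm
      _ ≤ ∑ _v : V, (1 / N * C) := sum_le_sum fun v _ => hP v
      _ = _ := by rw [sum_const, nsmul_eq_mul, card_univ]
  have htotal : ∑ f : V → Fin N × Λ, ((#{v | (f v).1 = 0} : ℝ)
        + #{v | ∃ T ∈ 𝒯, ∀ w, G.Adj v w → ¬ ((f w).1 = 0 ∧ (f w).2 ∈ S T)})
      ≤ ∑ _f : V → Fin N × Λ, (2 * Fintype.card V / N : ℝ) := by
    rw [sum_add_distrib, sum_const, nsmul_eq_mul, card_univ, Fintype.card_fun]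
    have h1 := key (fun f v => (f v).1 = 0) hB
    have h2 := key (fun f v => ∃ T ∈ 𝒯, ∀ w, G.Adj v w → ¬ ((f w).1 = 0 ∧ (f w).2 ∈ S T)) hbad
    push_cast at hC h1 h2 ⊢
    rw [← hC]
    refine (add_le_add h1 h2).trans (le_of_eq ?_)
    ring
  obtain ⟨f, -, hf⟩ := exists_le_of_sum_le univ_nonempty htotal
  refine ⟨f, _, fun v hv T hT => ?_, hf⟩
  by_contra! hw
  exact hv (mem_filter.2 ⟨mem_univ _, T, hT, fun w hvw h => hw w hvw h.1 h.2⟩)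

/-- The number of `s`-subsets of `F`, counted among the `s`-subsets of all of `Fin m`. -/
lemma choose_le_card_subset {m M s : ℕ} (F : Finset (Fin m)) (hF : M ≤ #F) :
    M.choose s ≤ #{l : powersetCard s (univ : Finset (Fin m)) | l.1 ⊆ F} := by
  refine (Nat.choose_le_choose s hF).trans ?_
  rw [← card_powersetCard]
  refine (card_le_card ?_).trans (card_image_le (f := Subtype.val))
  intro l hl
  obtain ⟨hl1, hl2⟩ := mem_powersetCard.1 hl
  exact mem_image.2 ⟨⟨l, mem_powersetCard.2 ⟨subset_univ _, hl2⟩⟩, by simpa using hl1, rfl⟩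

lemma card_powersetCard_fin (m s : ℕ) :
    Fintype.card (powersetCard s (univ : Finset (Fin m))) = m.choose s := by
  rw [Fintype.card_coe, card_powersetCard, card_univ, Fintype.card_fin]

open scoped Classical in
/-- Lists on a small set `B` of vertices such that every vertex of a large set `A` sees, under
any coloring of `B`, at least `M` colors cannot be completed to a colorable list assignment if
the number of colorings of `B` is small. -/
lemma not_choosable_of_lists {V : Type} [Fintype V] (G : SimpleGraph V) {m M s : ℕ} (hm : 0 < m)
    (hsm : s ≤ m) (A B : Finset V) (hAB : Disjoint A B) (LB : V → Finset (Fin m))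
    (hLB : ∀ v, #(LB v) = s)
    (hA : ∀ a ∈ A, ∀ c : V → Fin m, (∀ b ∈ B, c b ∈ LB b) →
      M ≤ #(image c {b ∈ B | G.Adj a b}))
    (q : ℝ) (hq : q * m.choose s ≤ M.choose s)
    (hcount : (s : ℝ) ^ #B * (1 - q) ^ #A < 1) : ¬ Choosable G s := by
  intro hG
  have hK : (0 : ℝ) < m.choose s := by exact_mod_cast Nat.choose_pos hsm
  let F : (V → Fin m) → V → Finset (Fin m) := fun c a => image c {b ∈ B | G.Adj a b}
  let P : Finset (V → Fin m) :=
    Fintype.piFinset fun v => if v ∈ B then LB v else {⟨0, hm⟩}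
  have hPcard : #P = s ^ #B := by
    rw [Fintype.card_piFinset]
    calc _ = ∏ v : V, if v ∈ B then s else 1 := by
          refine prod_congr rfl fun v _ => ?_
          by_cases hv : v ∈ B <;> simp [hv, hLB]
      _ = _ := by rw [prod_ite_mem, univ_inter, prod_const]
  let H : (V → Fin m) → Finset (V → powersetCard s (univ : Finset (Fin m))) := fun c =>
    {h | ∀ a ∈ A, ¬ (h a).1 ⊆ F c a}
  have hcover : (univ : Finset (V → powersetCard s (univ : Finset (Fin m)))) ⊆ P.biUnion H := by
    intro h _
    obtain ⟨c, hc, hproper⟩ := hG (Fin m) (fun v => if v ∈ B then LB v else (h v).1) (by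
      intro v
      by_cases hv : v ∈ B
      · simp [hv, hLB]
      · simpa [hv] using (mem_powersetCard.1 (h v).2).2.ge)
    refine mem_biUnion.2 ⟨fun v => if v ∈ B then c v else ⟨0, hm⟩, ?_, ?_⟩
    · refine Fintype.mem_piFinset.2 fun v => ?_
      by_cases hv : v ∈ B
      · simpa [hv] using hc v
      · simp [hv]
    · simp only [H, mem_filter, mem_univ, true_and]
      intro a ha hsub
      have haB : a ∉ B := disjoint_left.1 hAB ha
      have hca := hc a
      simp only [haB, if_false] at hca
      obtain ⟨b, hb, hbc⟩ := mem_image.1 (hsub hca)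
      obtain ⟨hbB, hab⟩ := mem_filter.1 hb
      simp only [hbB, if_true] at hbc
      exact hproper hab hbc.symm
  have hHcard : ∀ c ∈ P, (#(H c) : ℝ) ≤ (1 - q) ^ #A * (m.choose s : ℝ) ^ Fintype.card V := by
    intro c hc
    have h := card_filter_forall_mem_le A
      (fun a => ({l | ¬ l.1 ⊆ F c a} : Finset (powersetCard s (univ : Finset (Fin m)))))
      (1 - q) (fun a ha => ?_) (fun h => ∀ a ∈ A, ¬ (h a).1 ⊆ F c a)
      (fun f hf a ha => mem_filter.2 ⟨mem_univ _, hf a ha⟩)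
    · rw [card_powersetCard_fin] at h
      exact h
    have h1 : (M.choose s : ℝ) ≤ #{l : powersetCard s (univ : Finset (Fin m)) | l.1 ⊆ F c a} :=
      Nat.cast_le.2 <| choose_le_card_subset (F c a) <| hA a ha c fun b hb => by
        simpa [hb] using Fintype.mem_piFinset.1 hc b
    have h2 := card_filter_add_card_filter_not
      (s := (univ : Finset (powersetCard s (univ : Finset (Fin m))))) (fun l => l.1 ⊆ F c a)
    rw [card_univ, card_powersetCard_fin] at h2
    rw [card_powersetCard_fin, sub_mul, one_mul]
    have h2' := congrArg (Nat.cast (R := ℝ)) h2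
    rw [Nat.cast_add] at h2'
    linarith
  have hle : (m.choose s : ℝ) ^ Fintype.card V
      ≤ (s : ℝ) ^ #B * ((1 - q) ^ #A * (m.choose s : ℝ) ^ Fintype.card V) := by
    calc (m.choose s : ℝ) ^ Fintype.card V
        = (#(univ : Finset (V → powersetCard s (univ : Finset (Fin m)))) : ℝ) := by
          rw [card_univ, Fintype.card_fun, card_powersetCard_fin, Nat.cast_pow]
      _ ≤ ∑ c ∈ P, (#(H c) : ℝ) := by
          exact_mod_cast (card_le_card hcover).trans card_biUnion_le
      _ ≤ ∑ _c ∈ P, ((1 - q) ^ #A * (m.choose s : ℝ) ^ Fintype.card V) :=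
          sum_le_sum hHcard
      _ = _ := by rw [sum_const, nsmul_eq_mul, hPcard, Nat.cast_pow]
  have hpos : (0 : ℝ) < (m.choose s : ℝ) ^ Fintype.card V := pow_pos hK _
  rw [← mul_assoc] at hle
  exact absurd hle (not_le.2 (mul_lt_of_lt_one_left hpos hcount))

open scoped Classical in
/-- A graph of minimum degree at least `320 s ^ 3 4 ^ s` is not `s`-choosable. -/
lemma not_choosable_of_le_degree {V : Type} [Fintype V] [Nonempty V] (G : SimpleGraph V) (s : ℕ)
    (hs : 1 ≤ s) (hdeg : ∀ v, (320 * s ^ 3 * 4 ^ s : ℝ) ≤ (#{w | G.Adj v w} : ℝ)) :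
    ¬ Choosable G s := by
  have hs' : (1 : ℝ) ≤ s := by exact_mod_cast hs
  set M := 2 * s ^ 2 with hM
  have hMpos : 0 < M := by positivity
  have hsM : s ≤ M := by nlinarith
  obtain ⟨N, hN⟩ : ∃ N, N = s * 2 ^ (s + 4) := ⟨_, rfl⟩
  have : NeZero N := ⟨by rw [hN]; positivity⟩
  have hNr : (N : ℝ) = s * 2 ^ (s + 4) := by simp [hN]
  have hNpos : (0 : ℝ) < N := by rw [hNr]; positivity
  obtain ⟨q, hq⟩ : ∃ q : ℝ, q = 1 / 2 ^ (s + 1) := ⟨_, rfl⟩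
  have hq0 : 0 < q := by rw [hq]; positivity
  have hq1 : q ≤ 1 := by
    rw [hq, div_le_one (by positivity)]
    exact one_le_pow₀ (by norm_num)
  have hqc : q * (2 * M).choose s ≤ M.choose s := by
    have := choose_two_mul_le s
    rw [hq, one_div_mul_eq_div, div_le_iff₀ (by positivity)]
    linarith
  have : Nonempty (powersetCard s (univ : Finset (Fin (2 * M)))) := Fintype.card_pos_iff.1 (by
    rw [card_powersetCard_fin]; exact Nat.choose_pos (by omega))
  obtain ⟨f, X, hX, hf⟩ := exists_sparse_lists (Λ := powersetCard s (univ : Finset (Fin (2 * M)))) G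
    (powersetCard M univ) (fun T => {l | l.1 ⊆ T}) N q _ hq0.le hq1 (fun T hT => by
      rw [card_powersetCard_fin]
      exact hqc.trans (Nat.cast_le.2 (choose_le_card_subset T (mem_powersetCard.1 hT).2.ge)))
    hdeg (by
      have hT : ((#(powersetCard M (univ : Finset (Fin (2 * M)))) : ℕ) : ℝ)
          ≤ Real.exp (4 * s ^ 2) := by
        rw [card_powersetCard, card_univ, Fintype.card_fin]
        calc ((2 * M).choose M : ℝ) ≤ (2 : ℝ) ^ (2 * M) := by
              exact_mod_cast Nat.choose_le_two_pow (2 * M) M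
          _ ≤ Real.exp 1 ^ (2 * M) := by
              gcongr
              linarith [Real.add_one_le_exp 1]
          _ = Real.exp (4 * s ^ 2) := by
              rw [← Real.exp_nat_mul]; congr 1; simp [hM]; ring
      have hNexp : (N : ℝ) ≤ Real.exp (2 * s + 4) := by
        rw [hNr]
        calc (s : ℝ) * 2 ^ (s + 4) ≤ Real.exp s * Real.exp 1 ^ (s + 4) := by
              gcongr
              · linarith [Real.add_one_le_exp (s : ℝ)]
              · linarith [Real.add_one_le_exp 1]
          _ = Real.exp (2 * s + 4) := by
              rw [← Real.exp_nat_mul, ← Real.exp_add]; congr 1; push_cast; ring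
      have hexp : q / N * (320 * s ^ 3 * 4 ^ s) = 10 * s ^ 2 := by
        have h4 : (4 : ℝ) ^ s = 2 ^ s * 2 ^ s := by rw [← mul_pow]; norm_num
        rw [hq, hNr, h4, pow_add, pow_add]
        field_simp
        norm_num
      rw [hexp, le_div_iff₀ hNpos]
      calc _ ≤ Real.exp (4 * s ^ 2) * Real.exp (-(10 * s ^ 2)) * Real.exp (2 * s + 4) := by
            gcongr
        _ = Real.exp (-6 * s ^ 2 + 2 * s + 4) := by
            rw [← Real.exp_add, ← Real.exp_add]; congr 1; ring
        _ ≤ 1 := by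
            rw [Real.exp_le_one_iff]; nlinarith)
  set B : Finset V := {v | (f v).1 = 0} with hB
  have hn : (0 : ℝ) < Fintype.card V := by exact_mod_cast Fintype.card_pos
  have hBn : (#B : ℝ) ≤ 2 * Fintype.card V / N := by
    have : (0 : ℝ) ≤ #X := by positivity
    linarith
  have hN4 : (32 : ℝ) ≤ N := by
    rw [hNr, pow_add]
    have : (2 : ℝ) ≤ 2 ^ s := by
      calc (2 : ℝ) = 2 ^ 1 := by norm_num
        _ ≤ 2 ^ s := pow_le_pow_right₀ (by norm_num) hs
    nlinarith
  have hAn : (Fintype.card V : ℝ) / 2 ≤ #(B ∪ X)ᶜ := by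
    rw [card_compl, Nat.cast_sub (card_le_univ _)]
    have h1 : (#(B ∪ X) : ℝ) ≤ #B + #X := by exact_mod_cast card_union_le B X
    have h2 : 2 * (Fintype.card V : ℝ) / N ≤ Fintype.card V / 2 := by
      rw [div_le_div_iff₀ hNpos (by norm_num)]
      linarith [mul_le_mul_of_nonneg_left hN4 hn.le]
    linarith
  refine not_choosable_of_lists G (m := 2 * M) (M := M) (s := s) (by omega) (by omega)
    (B ∪ X)ᶜ B ?_ (fun v => (f v).2.1) (fun v => (mem_powersetCard.1 (f v).2.2).2) ?_ q hqc ?_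
  · rw [disjoint_left]
    intro a ha haB
    simp [haB] at ha
  · intro a ha c hc
    by_contra! hlt
    have haX : a ∉ X := fun h => by simp [h] at ha
    have hcompl : M ≤ #(image c {b ∈ B | G.Adj a b})ᶜ := by
      rw [card_compl, Fintype.card_fin]; omega
    obtain ⟨T, hTsub, hTcard⟩ := exists_subset_card_eq hcompl
    obtain ⟨b, hab, hb0, hbT⟩ :=
      hX a haX T (mem_powersetCard.2 ⟨subset_univ _, hTcard⟩)
    have hbB : b ∈ B := by rw [hB, mem_filter]; exact ⟨mem_univ _, hb0⟩
    have hcb := hTsub ((mem_filter.1 hbT).2 (hc b hbB))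
    exact mem_compl.1 hcb (mem_image_of_mem c (mem_filter.2 ⟨hbB, hab⟩))
  · calc (s : ℝ) ^ #B * (1 - q) ^ #(B ∪ X)ᶜ
        ≤ Real.exp s ^ #B * Real.exp (-q) ^ #(B ∪ X)ᶜ := by
          have : 0 ≤ 1 - q := by linarith
          gcongr
          · linarith [Real.add_one_le_exp (s : ℝ)]
          · exact Real.one_sub_le_exp_neg _
      _ = Real.exp (#B * s - #(B ∪ X)ᶜ * q) := by
          rw [← Real.exp_nat_mul, ← Real.exp_nat_mul, ← Real.exp_add]; congr 1; ring
      _ < 1 := by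
          rw [Real.exp_lt_one_iff]
          have h1 : (#B : ℝ) * s ≤ 2 * Fintype.card V / N * s := by gcongr
          have h2 : 2 * (Fintype.card V : ℝ) / N * s = Fintype.card V / 4 * q := by
            rw [hq, hNr, pow_add, pow_add]
            field_simp
            norm_num
          have h3 : (Fintype.card V : ℝ) / 2 * q ≤ #(B ∪ X)ᶜ * q := by gcongr
          have h4 : 0 < Fintype.card V * q := by positivity
          linarith

open scoped Classical in
/-- A graph of average degree at least `2 D > 0` has an induced subgraph of minimum degree at
least `D`. -/
lemma exists_induce_minDegree {V : Type*} [Fintype V] [Nonempty V] (G : SimpleGraph V) (D : ℝ)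
    (hD : 0 < D) (hG : 2 * D * Fintype.card V ≤ ∑ v, (#{w | G.Adj v w} : ℝ)) :
    ∃ W : Finset V, W.Nonempty ∧ ∀ v ∈ W, D ≤ (#{w ∈ W | G.Adj v w} : ℝ) := by
  let p : Finset V → Prop := fun W =>
    W.Nonempty ∧ 2 * D * #W ≤ ∑ v ∈ W, (#{w ∈ W | G.Adj v w} : ℝ)
  have hp : ∃ W, p W := ⟨univ, univ_nonempty, by simpa using hG⟩
  obtain ⟨W, hWp, hmin⟩ := exists_min_image ({W | p W} : Finset (Finset V)) card
    (by obtain ⟨W, h⟩ := hp; exact ⟨W, by simpa using h⟩)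
  obtain ⟨hWne, hW⟩ := (mem_filter.1 hWp).2
  refine ⟨W, hWne, fun v hv => ?_⟩
  by_contra! hlt
  have hsum : ∑ u ∈ W, (#{w ∈ W | G.Adj u w} : ℝ)
      = ∑ u ∈ W.erase v, (#{w ∈ W.erase v | G.Adj u w} : ℝ) + 2 * #{w ∈ W | G.Adj v w} := by
    have h1 : ∀ u, (#{w ∈ W | G.Adj u w} : ℝ)
        = #{w ∈ W.erase v | G.Adj u w} + if G.Adj u v then 1 else 0 := by
      intro u
      simp only [card_filter, Nat.cast_sum]
      rw [← sum_erase_add _ _ hv]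
      simp
    have h2 : (#{w ∈ W | G.Adj v w} : ℝ) = ∑ u ∈ W.erase v, if G.Adj u v then (1 : ℝ) else 0 := by
      rw [h1 v, card_filter]
      simp [G.adj_comm]
    rw [← sum_erase_add _ _ hv, sum_congr rfl fun u _ => h1 u, sum_add_distrib, ← h2]
    ring
  have hcard : (#(W.erase v) : ℝ) = #W - 1 := by
    rw [card_erase_of_mem hv, Nat.cast_sub hWne.card_pos, Nat.cast_one]
  have hne : (W.erase v).Nonempty := by
    by_contra hempty
    rw [not_nonempty_iff_eq_empty] at hempty
    rw [hempty] at hsum hcard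
    simp only [sum_empty, card_empty, Nat.cast_zero] at hsum hcard
    have : (#W : ℝ) = 1 := by linarith
    rw [this] at hW
    linarith
  have := hmin (W.erase v) (mem_filter.2 ⟨mem_univ _, hne, by rw [hcard]; linarith⟩)
  exact absurd this (not_le.2 (card_erase_lt_of_mem hv))

lemma Choosable.mono {V : Type} {G : SimpleGraph V} {k l : ℕ} (h : Choosable G k) (hkl : k ≤ l) :
    Choosable G l :=
  fun α L hL => h α L fun v => hkl.trans (hL v)

lemma Choosable.induce {V : Type} {G : SimpleGraph V} {k : ℕ} (h : Choosable G k) {W : Set V}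
    (hW : W.Nonempty) : Choosable (G.induce W) k := by
  classical
  intro α L hL
  obtain ⟨w, hw⟩ := hW
  obtain ⟨c, hc, hproper⟩ := h α (fun v => if hv : v ∈ W then L ⟨v, hv⟩ else L ⟨w, hw⟩) (by
    intro v
    by_cases hv : v ∈ W <;> simp [hv, hL])
  exact ⟨fun v => c v, fun v => by simpa using hc v, fun u v huv => hproper huv⟩

lemma choosable_card {V : Type} [Fintype V] (G : SimpleGraph V) :
    Choosable G (Fintype.card V) := by
  classical
  intro α L hL
  obtain ⟨c, hinj, hc⟩ := (all_card_le_biUnion_card_iff_exists_injective L).1 fun Z => by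
    rcases Z.eq_empty_or_nonempty with rfl | ⟨v, hv⟩
    · simp
    · exact (card_le_univ Z).trans ((hL v).trans (card_le_card (subset_biUnion_of_mem L hv)))
  exact ⟨c, hc, fun u v huv h => huv.ne (hinj h)⟩

lemma choosable_listChromaticNumber {V : Type} [Fintype V] (G : SimpleGraph V) :
    Choosable G (listChromaticNumber G) :=
  Nat.sInf_mem (s := {k | Choosable G k}) ⟨_, choosable_card G⟩

open scoped Classical in
lemma not_choosable_of_le_sum_degree {V : Type} [Fintype V] [Nonempty V] (G : SimpleGraph V)
    (s : ℕ) (hs : 1 ≤ s)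
    (hG : (640 * s ^ 3 * 4 ^ s : ℝ) * Fintype.card V ≤ ∑ v, (#{w | G.Adj v w} : ℝ)) :
    ¬ Choosable G s := by
  intro h
  have hs' : (1 : ℝ) ≤ s := by exact_mod_cast hs
  obtain ⟨W, hWne, hW⟩ := exists_induce_minDegree G (320 * s ^ 3 * 4 ^ s) (by positivity)
    (le_trans (le_of_eq (by ring)) hG)
  have : Nonempty (W : Set V) := hWne.to_subtype
  refine not_choosable_of_le_degree (G.induce (W : Set V)) s hs (fun v => ?_)
    (h.induce (W := (W : Set V)) hWne)
  refine (hW v v.2).trans (Nat.cast_le.2 ?_)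
  refine (card_le_card ?_).trans (card_image_le (f := Subtype.val))
  intro w hw
  obtain ⟨hwW, hvw⟩ := mem_filter.1 hw
  exact mem_image.2 ⟨⟨w, hwW⟩, by simpa using hvw, rfl⟩

/-- A graph of average degree at least `640 s ^ 3 4 ^ s` is not `s`-choosable. -/
lemma not_choosable_of_le_average {V : Type} [Fintype V] [Nonempty V] (G : SimpleGraph V)
    [DecidableRel G.Adj] (s : ℕ) (hs : 1 ≤ s)
    (hG : (640 * s ^ 3 * 4 ^ s : ℝ) ≤ 2 * G.edgeFinset.card / Fintype.card V) :
    ¬ Choosable G s := by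
  refine not_choosable_of_le_sum_degree G s hs ?_
  have hn : (0 : ℝ) < Fintype.card V := by exact_mod_cast Fintype.card_pos
  rw [le_div_iff₀ hn] at hG
  refine hG.trans (le_of_eq ?_)
  have h := G.sum_degrees_eq_twice_card_edges
  simp only [← SimpleGraph.card_neighborFinset_eq_degree,
    SimpleGraph.neighborFinset_eq_filter] at h
  have h' := congrArg (Nat.cast (R := ℝ)) h
  push_cast at h'
  rw [← h']
  refine sum_congr rfl fun v _ => ?_
  congr!

lemma eventually_logb_pow_le_rpow (ε : ℝ) (hε : 0 < ε) :
    ∀ᶠ d : ℝ in Filter.atTop, 640 * Real.logb 2 d ^ 3 ≤ d ^ (2 * ε) := by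
  have hlog2 : 0 < Real.log 2 := Real.log_pos (by norm_num)
  have h := (isLittleO_log_rpow_rpow_atTop (s := 2 * ε) 3 (by positivity)).bound
    (c := Real.log 2 ^ 3 / 640) (by positivity)
  filter_upwards [h, Filter.eventually_ge_atTop 1] with d hd hd1
  have hlog : 0 ≤ Real.log d := Real.log_nonneg hd1
  rw [Real.norm_of_nonneg (by positivity), Real.norm_of_nonneg (by positivity)] at hd
  have hdlog : Real.log d ^ 3 ≤ Real.log 2 ^ 3 / 640 * d ^ (2 * ε) := by exact_mod_cast hd
  rw [Real.logb, div_pow, mul_div_assoc', div_le_iff₀ (by positivity)]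
  linear_combination 640 * hdlog

/-- **Theorem 1 (Alon).** For every `ε > 0` there is `d₀` such that every finite simple
graph `G` with average degree `d = 2|E(G)|/|V(G)| ≥ d₀` satisfies
`χ_ℓ(G) ≥ (1/2 − ε)·log₂ d`. -/
theorem alon_listChromaticNumber_lower_bound :
    ∀ ε : ℝ, 0 < ε → ∃ d₀ : ℝ,
      ∀ (V : Type) [Fintype V] (G : SimpleGraph V) [DecidableRel G.Adj] (d : ℝ),
        d = 2 * G.edgeFinset.card / Fintype.card V → d₀ ≤ d →
        (1 / 2 - ε) * Real.logb 2 d ≤ (listChromaticNumber G : ℝ) := by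
  intro ε hε
  obtain ⟨d₁, hd₁⟩ := Filter.eventually_atTop.1 (eventually_logb_pow_le_rpow ε hε)
  refine ⟨max d₁ 2560, fun V _ G _ d hd hle => ?_⟩
  have hd1 := hd₁ d ((le_max_left _ _).trans hle)
  have hd2 : 2560 ≤ d := (le_max_right _ _).trans hle
  have hdpos : 0 < d := by linarith
  by_contra! hlt
  have hcard : Fintype.card V ≠ 0 := fun h0 => by
    rw [h0, Nat.cast_zero, div_zero] at hd
    linarith
  have : Nonempty V := Fintype.card_pos_iff.1 (Nat.pos_of_ne_zero hcard)
  have hch := choosable_listChromaticNumber G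
  rcases Nat.eq_zero_or_pos (listChromaticNumber G) with h0 | hpos
  · refine not_choosable_of_le_average G 1 le_rfl ?_ (hch.mono (by omega))
    rw [← hd]
    norm_num
    exact hd2
  · refine not_choosable_of_le_average G _ hpos ?_ hch
    rw [← hd]
    set k := listChromaticNumber G
    have hlogb : 0 ≤ Real.logb 2 d := Real.logb_nonneg (by norm_num) (by linarith)
    have hk : (k : ℝ) ≤ Real.logb 2 d := by nlinarith
    have h4 : (4 : ℝ) ^ k ≤ d ^ (1 - 2 * ε) := by
      calc (4 : ℝ) ^ k = (2 : ℝ) ^ (2 * (k : ℝ)) := by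
            rw [Real.rpow_mul (by norm_num), Real.rpow_natCast]; norm_num
        _ ≤ (2 : ℝ) ^ (Real.logb 2 d * (1 - 2 * ε)) := by
            refine Real.rpow_le_rpow_of_exponent_le (by norm_num) ?_
            linarith
        _ = d ^ (1 - 2 * ε) := by
            rw [Real.rpow_mul (by norm_num), Real.rpow_logb (by norm_num) (by norm_num) hdpos]
    calc (640 * k ^ 3 * 4 ^ k : ℝ) ≤ 640 * Real.logb 2 d ^ 3 * d ^ (1 - 2 * ε) := by gcongr
      _ ≤ d ^ (2 * ε) * d ^ (1 - 2 * ε) := by gcongr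
      _ = d := by rw [← Real.rpow_add hdpos]; simp
end
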